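/- arXiv:1308.2698 — 2 statements merged into one kernel-verified Lean document; each statement's English description precedes it below -/
import Mathlib

section
/- A rank-d matroid M on [n] is a positroid if and only if there exist real numbers a_{i,j} for i,j ∈ [n] such that the matroid polytope Γ_M equals the set of x ∈ ℝ^n satisfying x_1 + ... + x_n = d and, for all i,j ∈ [n], the sum of x_ℓ over ℓ in the cyclic interval [i,j] is at most a_{i,j}. -/
open Finset

/-- A full-row-rank real `d × n` matrix is *totally nonnegative* if all of its
maximal (`d × d`) minors are nonnegative.  Columns are indexed by a finite
linearly ordered set `E`; a maximal minor is indexed by a strictly increasing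
choice of `d` columns. -/
def Matrix.TotallyNonneg {d : ℕ} {E : Type*} [Fintype E] [LinearOrder E]
    (A : Matrix (Fin d) E ℝ) : Prop :=
  A.rank = d ∧ ∀ f : Fin d → E, StrictMono f → 0 ≤ (A.submatrix id f).det

/-- `ℬ` is the collection of bases of the column matroid `M(A)`: the `d`-element
sets of column indices whose columns are linearly independent. -/
def Matrix.RepresentsBases {d : ℕ} {E : Type*} [Fintype E]
    (A : Matrix (Fin d) E ℝ) (ℬ : Finset E → Prop) : Prop :=
  ∀ B : Finset E, ℬ B ↔ B.card = d ∧ LinearIndependent ℝ (fun j : B => fun i => A i j.1)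

/-- A positroid of rank `d` on the finite linearly ordered ground set `E`,
given by its collection of bases `ℬ`. -/
def IsPositroidOfRank (d : ℕ) {E : Type*} [Fintype E] [LinearOrder E]
    (ℬ : Finset E → Prop) : Prop :=
  ∃ A : Matrix (Fin d) E ℝ, A.TotallyNonneg ∧ A.RepresentsBases ℬ

/-- A positroid on the finite linearly ordered ground set `E`. -/
def IsPositroid {E : Type*} [Fintype E] [LinearOrder E] (ℬ : Finset E → Prop) : Prop :=
  ∃ d, IsPositroidOfRank d ℬ


/-- The basis-exchange axiom: `ℬ` is the (nonempty) collection of bases of a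
matroid on the ground set `E`. -/
def IsBasesSet {E : Type*} [DecidableEq E] (ℬ : Finset E → Prop) : Prop :=
  (∃ B, ℬ B) ∧
  ∀ ⦃B₁ B₂ : Finset E⦄, ℬ B₁ → ℬ B₂ → ∀ b₁ ∈ B₁ \ B₂,
    ∃ b₂ ∈ B₂ \ B₁, ℬ (insert b₂ (B₁.erase b₁))

/-- Lexicographic order on two `d`-element subsets of `Fin n` (with respect to
the standard order): comparing the increasing enumerations `s_1 < ... < s_d`
and `t_1 < ... < t_d`, either they agree or they first differ at an index `k`
where `s_k < t_k`. -/
def LexLE {n : ℕ} (d : ℕ) (S T : Finset (Fin n)) : Prop :=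
  ∃ (hS : S.card = d) (hT : T.card = d),
    S = T ∨ ∃ k : Fin d,
      (∀ l, l < k → ((S.orderIsoOfFin hS) l : Fin n) = ((T.orderIsoOfFin hT) l : Fin n)) ∧
      ((S.orderIsoOfFin hS) k : Fin n) < ((T.orderIsoOfFin hT) k : Fin n)

/-- Gale order on two `d`-element subsets of `Fin n` (with respect to the
standard order): the increasing enumerations satisfy `s_k ≤ t_k` for all `k`. -/
def GaleLE {n : ℕ} (d : ℕ) (S T : Finset (Fin n)) : Prop :=
  ∃ (hS : S.card = d) (hT : T.card = d),
    ∀ k : Fin d, ((S.orderIsoOfFin hS) k : Fin n) ≤ ((T.orderIsoOfFin hT) k : Fin n)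

/-- The matroid (basis) polytope: the convex hull in `ℝ^n` of the indicator
vectors of the bases of the matroid with basis collection `ℬ`. -/
def matroidPolytope {n : ℕ} (ℬ : Finset (Fin n) → Prop) : Set (Fin n → ℝ) :=
  convexHull ℝ {x : Fin n → ℝ | ∃ B, ℬ B ∧ x = fun i => if i ∈ B then (1 : ℝ) else 0}

/-- The closed cyclic interval `[i, j] = {i, i+1, ..., j}` (cyclically) in `Fin n`. -/
def cycInt {n : ℕ} (i j : Fin n) : Finset (Fin n) :=
  Finset.univ.filter fun ℓ => (ℓ - i).val ≤ (j - i).val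


/-! ## Cyclic order and crossing -/

/-- `a, b, c, d` are in cyclic order. -/
def Cyc4 {n : ℕ} (a b c d : Fin n) : Prop :=
  (a < b ∧ b < c ∧ c < d) ∨ (b < c ∧ c < d ∧ d < a) ∨ (c < d ∧ d < a ∧ a < b) ∨
    (d < a ∧ a < b ∧ b < c)

/-- The chords `{s,l}` and `{p,q}` cross. -/
def Cross {n : ℕ} (s l p q : Fin n) : Prop := Cyc4 s p l q ∨ Cyc4 s q l p

/-- Position of `z` relative to `q`. -/
def rpos {n : ℕ} (q z : Fin n) : ℕ :=
  if q.val ≤ z.val then z.val - q.val else n + z.val - q.val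

theorem sub_val_eq_rpos {n : ℕ} (q z : Fin n) : (z - q).val = rpos q z := by
  unfold rpos
  rw [Fin.sub_def]
  have h1 := q.isLt
  have h2 := z.isLt
  simp only
  split_ifs with h
  · have : n - q.val + z.val = (z.val - q.val) + n := by omega
    rw [this, Nat.add_mod_right, Nat.mod_eq_of_lt (by omega)]
  · rw [Nat.mod_eq_of_lt (by omega)]; omega

theorem mem_cycInt {n : ℕ} (i j z : Fin n) : z ∈ cycInt i j ↔ rpos i z ≤ rpos i j := by
  simp [cycInt, sub_val_eq_rpos]

theorem rpos_inj {n : ℕ} {q a b : Fin n} (h : rpos q a = rpos q b) : a = b := by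
  unfold rpos at h
  have h1 := a.isLt
  have h2 := b.isLt
  have h3 := q.isLt
  ext
  split_ifs at h <;> omega

theorem rpos_self {n : ℕ} (q : Fin n) : rpos q q = 0 := by simp [rpos]

theorem cyc4_of_rpos {n : ℕ} {q a b c d : Fin n} (h1 : rpos q a < rpos q b)
    (h2 : rpos q b < rpos q c) (h3 : rpos q c < rpos q d) : Cyc4 a b c d := by
  unfold rpos at *
  unfold Cyc4
  simp only [Fin.lt_def]
  have ha := a.isLt
  have hb := b.isLt
  have hc := c.isLt
  have hd := d.isLt
  have hq := q.isLt
  split_ifs at h1 h2 h3 <;> omega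

theorem mem_cycInt_of_rpos {n : ℕ} {q s e z : Fin n} (h : rpos q s ≤ rpos q e) :
    z ∈ cycInt s e ↔ rpos q s ≤ rpos q z ∧ rpos q z ≤ rpos q e := by
  rw [mem_cycInt]
  unfold rpos at *
  have ha := s.isLt
  have hb := e.isLt
  have hc := z.isLt
  have hq := q.isLt
  split_ifs at h ⊢ <;> omega

theorem Cyc4.rot {n : ℕ} {a b c d : Fin n} (h : Cyc4 a b c d) : Cyc4 b c d a := by
  unfold Cyc4 at *; tauto

theorem Cross.symm {n : ℕ} {a b c d : Fin n} (h : Cross a b c d) : Cross a b d c := by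
  unfold Cross at *; tauto

theorem Cross.symm' {n : ℕ} {a b c d : Fin n} (h : Cross a b c d) : Cross b a c d := by
  rcases h with h | h
  · exact Or.inr h.rot.rot
  · exact Or.inl h.rot.rot

theorem Cross.cycInt {n : ℕ} {s l p q i j : Fin n} (h : Cross s l p q) (hs : s ∈ cycInt i j)
    (hl : l ∈ cycInt i j) : p ∈ cycInt i j ∨ q ∈ cycInt i j := by
  rw [mem_cycInt] at *
  rw [mem_cycInt]
  have ha := s.isLt
  have hb := l.isLt
  have hc := p.isLt
  have hq := q.isLt
  have hi := i.isLt
  have hj := j.isLt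
  rcases h with h | h <;> rcases h with h | h | h | h <;> simp only [Fin.lt_def] at h <;>
    unfold rpos at * <;> split_ifs at hs hl ⊢ <;> omega

/-! ## Matroid basics -/

/-- Noncrossing matroids. -/
def NC {n : ℕ} (M : Matroid (Fin n)) : Prop :=
  ∀ (T : Set (Fin n)) (l s p q : Fin n), M.IsBase (insert p T) → p ∉ T → q ∉ M.closure T →
    l ∈ T → s ∈ M.closure T → s ∉ M.closure (T \ {l}) → Cross s l p q → False

theorem fund_mem_closure {α : Type*} {M : Matroid α} {I G : Set α} {k : α} (hI : M.Indep I)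
    (hk : k ∈ M.closure I) (h : ∀ i ∈ I, k ∉ M.closure (I \ {i}) → i ∈ G) :
    k ∈ M.closure (I ∩ G) := by
  by_cases hkI : k ∈ I
  · have := h k hkI (hI.notMem_closure_sdiff_of_mem hkI)
    exact M.mem_closure_of_mem' ⟨hkI, this⟩ (hI.subset_ground hkI)
  · have hC := hI.fundCircuit_isCircuit hk hkI
    have h1 : k ∈ M.closure (M.fundCircuit k I \ {k}) :=
      hC.mem_closure_sdiff_singleton_of_mem (M.mem_fundCircuit k I)
    refine M.closure_subset_closure ?_ h1
    rintro i ⟨hi, hik⟩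
    have hiI : i ∈ I := by
      rcases M.fundCircuit_subset_insert k I hi with h | h
      · exact absurd h hik
      · exact h
    refine ⟨hiI, h i hiI ?_⟩
    rw [hI.mem_fundCircuit_iff hk hkI] at hi
    intro hcl
    have hne : k ≠ i := fun h => hik h.symm
    have h2 := hi.notMem_closure_sdiff_of_mem (e := k) (by simp [hne])
    apply h2
    refine M.closure_subset_closure ?_ hcl
    rintro z ⟨hz1, hz2⟩
    refine ⟨⟨Or.inr hz1, hz2⟩, ?_⟩
    rintro rfl
    exact hkI hz1

/-- If `k ∉ cl(I ∩ G)` there is a witness of the fundamental circuit outside `G`. -/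
theorem exists_fund_of_notMem {α : Type*} {M : Matroid α} {I G : Set α} {k : α} (hI : M.Indep I)
    (hk : k ∈ M.closure I) (h : k ∉ M.closure (I ∩ G)) :
    ∃ i ∈ I, i ∉ G ∧ k ∉ M.closure (I \ {i}) := by
  by_contra hcon
  push Not at hcon
  exact h (fund_mem_closure hI hk fun i hi h1 => by
    by_contra h2
    exact h1 (hcon i hi h2))

/-- A base decomposed. -/
theorem base_notMem_closure {α : Type*} {M : Matroid α} {T : Set α} {p : α}
    (h : M.IsBase (insert p T)) (hp : p ∉ T) : p ∉ M.closure T := by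
  have := h.indep.notMem_closure_sdiff_of_mem (e := p) (by simp)
  simpa [hp] using this

theorem base_swap {α : Type*} {M : Matroid α} {T : Set α} {p q : α} (hE : M.E = Set.univ)
    (h : M.IsBase (insert p T)) (hp : p ∉ T) (hq : q ∉ M.closure T) : M.IsBase (insert q T) := by
  have h1 : (insert p T) \ {p} = T := by simp [hp]
  have := h.exchange_base_of_notMem_closure (e := p) (f := q) (by simp)
    (by rw [h1]; exact hq) (by simp [hE])
  rwa [h1] at this

theorem tight_card {n : ℕ} {M : Matroid (Fin n)} {B F : Finset (Fin n)}
    (hB : M.IsBase ↑B) (hF : (F : Set (Fin n)) ⊆ M.closure (↑B ∩ ↑F)) :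
    (M.eRk (F : Set (Fin n))).toNat = (B ∩ F).card := by
  have h : M.IsBasis (↑B ∩ ↑F) (F : Set (Fin n)) :=
    (hB.indep.subset Set.inter_subset_left).isBasis_of_subset_of_subset_closure
      Set.inter_subset_right hF
  rw [← h.encard_eq_eRk, ← Finset.coe_inter, Set.encard_coe_eq_coe_finsetCard]
  rfl

theorem card_le_rk {n : ℕ} {M : Matroid (Fin n)} {B F : Finset (Fin n)}
    (hB : M.Indep ↑B) : (B ∩ F).card ≤ (M.eRk (F : Set (Fin n))).toNat := by
  have h : ((B ∩ F : Finset (Fin n)) : Set (Fin n)).encard ≤ M.eRk (F : Set (Fin n)) := by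
    apply Matroid.Indep.encard_le_eRk_of_subset
    · exact hB.subset (by simp)
    · simp
  rw [Set.encard_coe_eq_coe_finsetCard] at h
  have h2 : M.eRk (F : Set (Fin n)) ≠ ⊤ := by
    have := M.eRk_le_encard (F : Set (Fin n))
    rw [Set.encard_coe_eq_coe_finsetCard] at this
    exact ne_top_of_le_ne_top (by simp) this
  rw [← ENat.natCast_toNat h2] at h
  exact_mod_cast h


/-! ## Noncrossing matroids have polytopes cut out by cyclic intervals -/

theorem poly_case_two {n : ℕ} (M : Matroid (Fin n)) (hE : M.E = Set.univ)
    (B : Finset (Fin n)) (hB : M.IsBase ↑B) (y : Fin n → ℝ)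
    (hy : ∀ i j, ∑ z ∈ cycInt i j, y z ≤ ((M.eRk (cycInt i j : Set (Fin n))).toNat : ℝ))
    (q : Fin n) :
    ∀ F : Finset (Fin n), (F : Set (Fin n)) ⊆ M.closure (↑B ∩ ↑F) →
      (∀ i ∈ B, i ∈ F → ∀ k ∈ F, k ∉ M.closure (↑B \ {i}) → ∀ w,
        (rpos q i < rpos q w ∧ rpos q w < rpos q k) ∨
        (rpos q k < rpos q w ∧ rpos q w < rpos q i) → w ∈ F) →
      ∑ z ∈ F, y z ≤ ((B ∩ F).card : ℝ) := by
  intro F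
  induction F using Finset.strongInduction with
  | H F ih =>
  intro hF hconn
  rcases F.eq_empty_or_nonempty with rfl | hne
  · simp
  obtain ⟨s, hsF, hs⟩ := Finset.exists_min_image F (rpos q) hne
  obtain ⟨e, heF, he⟩ := Finset.exists_max_image
    (F.filter fun e => ∀ w, rpos q s ≤ rpos q w → rpos q w ≤ rpos q e → w ∈ F) (rpos q)
    ⟨s, by
      simp only [Finset.mem_filter]
      refine ⟨hsF, fun w h1 h2 => ?_⟩
      rwa [rpos_inj (le_antisymm h2 h1)]⟩
  simp only [Finset.mem_filter] at heF he
  have hse : rpos q s ≤ rpos q e := hs e heF.1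
  set A := cycInt s e with hA
  have hAmem : ∀ z, z ∈ A ↔ rpos q s ≤ rpos q z ∧ rpos q z ≤ rpos q e :=
    fun z => mem_cycInt_of_rpos hse
  have hAF : A ⊆ F := fun z hz => heF.2 z ((hAmem z).1 hz).1 ((hAmem z).1 hz).2
  have hlt : ∀ k ∈ F, k ∉ A → rpos q e < rpos q k := by
    intro k hk hkA
    by_contra h
    exact hkA ((hAmem k).2 ⟨hs k hk, by omega⟩)
  have hsep : ∀ i ∈ A, ∀ k ∈ F, k ∉ A →
      ∃ w, rpos q i < rpos q w ∧ rpos q w < rpos q k ∧ w ∉ F := by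
    intro i hi k hk hkA
    by_contra hcon
    push Not at hcon
    have h1 := hlt k hk hkA
    have h2 := he k ⟨hk, fun w hw1 hw2 => by
      by_cases h : rpos q w ≤ rpos q e
      · exact heF.2 w hw1 h
      · by_cases h' : rpos q w = rpos q k
        · rwa [rpos_inj h']
        · exact hcon w (by have := ((hAmem i).1 hi).2; omega) (by omega)⟩
    omega
  have hBcl : ∀ z, z ∈ M.closure (B : Set (Fin n)) := by
    intro z; rw [hB.closure_eq, hE]; trivial
  have hfund : ∀ k ∈ F, ∀ i ∈ B, k ∉ M.closure (↑B \ {i}) → i ∈ F := by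
    intro k hk i hi hcl
    by_contra hiF
    apply hcl
    refine M.closure_subset_closure ?_ (hF hk)
    rintro z ⟨h1, h2⟩
    refine ⟨h1, ?_⟩
    rintro rfl
    exact hiF h2
  have hAt : (A : Set (Fin n)) ⊆ M.closure (↑B ∩ ↑A) := by
    intro k hk
    refine fund_mem_closure hB.indep (hBcl k) fun i hi hcl => ?_
    by_contra hiA
    have hkF : k ∈ F := hAF hk
    have hiF := hfund k hkF i hi hcl
    obtain ⟨w, h1, h2, h3⟩ := hsep k hk i hiF hiA
    exact h3 (hconn i hi hiF k hkF hcl w (Or.inr ⟨h1, h2⟩))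
  have hFt : ((F \ A : Finset (Fin n)) : Set (Fin n)) ⊆
      M.closure (↑B ∩ ((F \ A : Finset (Fin n)) : Set (Fin n))) := by
    intro k hk
    have hk' : k ∈ F ∧ k ∉ A := by simpa using hk
    refine fund_mem_closure hB.indep (hBcl k) fun i hi hcl => ?_
    have hiF := hfund k hk'.1 i hi hcl
    by_contra hiA
    have hiA' : i ∈ A := by
      by_contra h
      apply hiA
      simp [hiF, h]
    obtain ⟨w, h1, h2, h3⟩ := hsep i hiA' k hk'.1 hk'.2
    exact h3 (hconn i hi hiF k hk'.1 hcl w (Or.inl ⟨h1, h2⟩))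
  have hsA : s ∈ A := (hAmem s).2 ⟨le_refl _, hse⟩
  have hss : F \ A ⊂ F := by
    refine ⟨Finset.sdiff_subset, fun h => ?_⟩
    have := h hsF
    simp [hsA] at this
  have h1 := ih (F \ A) hss hFt (by
    intro i hi hiF k hk hcl w hw
    have hi' : i ∈ F ∧ i ∉ A := by simpa using hiF
    have hk' : k ∈ F ∧ k ∉ A := by simpa using hk
    have hwF := hconn i hi hi'.1 k hk'.1 hcl w hw
    have e1 := hlt i hi'.1 hi'.2
    have e2 := hlt k hk'.1 hk'.2
    simp only [Finset.mem_sdiff]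
    refine ⟨hwF, fun h => ?_⟩
    have := ((hAmem w).1 h).2
    omega)
  have h2 := hy s e
  rw [tight_card hB hAt] at h2
  have h3 : ∑ z ∈ F \ A, y z + ∑ z ∈ A, y z = ∑ z ∈ F, y z := Finset.sum_sdiff hAF
  have h4 : (B ∩ F).card = (B ∩ (F \ A)).card + (B ∩ A).card := by
    rw [← Finset.card_union_of_disjoint]
    · congr 1
      ext z
      simp only [Finset.mem_inter, Finset.mem_union, Finset.mem_sdiff]
      have := @hAF z
      tauto
    · rw [Finset.disjoint_left]
      intro z
      simp only [Finset.mem_inter, Finset.mem_sdiff]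
      tauto
  rw [h4]
  push_cast
  linarith

theorem poly_core {n : ℕ} (M : Matroid (Fin n)) (hE : M.E = Set.univ) (hNC : NC M)
    (B : Finset (Fin n)) (hB : M.IsBase ↑B) (y : Fin n → ℝ) (hsum : ∑ z, y z = (B.card : ℝ))
    (hy : ∀ i j, ∑ z ∈ cycInt i j, y z ≤ ((M.eRk (cycInt i j : Set (Fin n))).toNat : ℝ)) :
    ∀ F : Finset (Fin n), (F : Set (Fin n)) ⊆ M.closure (↑B ∩ ↑F) →
      ∑ z ∈ F, y z ≤ ((B ∩ F).card : ℝ) := by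
  intro F
  induction hm : (Fᶜ).card using Nat.strong_induction_on generalizing F with
  | h m ih =>
  intro hF
  by_cases hu : F = Finset.univ
  · subst hu
    simp [hsum]
  obtain ⟨q, hq⟩ : ∃ q, q ∉ F := by
    by_contra h
    push Not at h
    exact hu (Finset.eq_univ_of_forall h)
  by_cases hconn : ∀ i ∈ B, i ∈ F → ∀ k ∈ F, k ∉ M.closure (↑B \ {i}) → ∀ w,
        (rpos q i < rpos q w ∧ rpos q w < rpos q k) ∨
        (rpos q k < rpos q w ∧ rpos q w < rpos q i) → w ∈ F
  · exact poly_case_two M hE B hB y hy q F hF hconn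
  push Not at hconn
  obtain ⟨i, hiB, hiF, k, hkF, hcl, w, hw, hwF⟩ := hconn
  have hik : i ≠ k := by
    rintro rfl
    omega
  obtain ⟨btw, hbtw⟩ : ∃ btw : Fin n → Prop, ∀ z, btw z ↔
      ((rpos q i < rpos q z ∧ rpos q z < rpos q k) ∨
        (rpos q k < rpos q z ∧ rpos q z < rpos q i)) := ⟨_, fun _ => Iff.rfl⟩
  classical
  set F1 := F ∪ Finset.univ.filter btw with hF1
  set F2 := F ∪ Finset.univ.filter (fun z => ¬ btw z) with hF2
  have hqb : ¬ btw q := by rw [hbtw]; simp [rpos_self]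
  have hBcl : ∀ z, z ∈ M.closure (B : Set (Fin n)) := by
    intro z; rw [hB.closure_eq, hE]; trivial
  -- the noncrossing argument
  have key : ∀ z l, z ∉ F → l ∉ F → l ∈ B → z ∉ M.closure (↑B \ {l}) → (btw z ↔ ¬ btw l) →
      False := by
    intro z l hz hl hlB hzl hb
    have hli : i ≠ l := by rintro rfl; exact hl hiF
    have hkl : k ≠ l := by rintro rfl; exact hl hkF
    have hiz : i ≠ z := by rintro rfl; exact hz hiF
    have hkz : k ≠ z := by rintro rfl; exact hz hkF
    refine hNC (↑B \ {l}) i k l z ?_ (by simp) hzl ⟨hiB, hli⟩ ?_ ?_ ?_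
    · rw [Set.insert_sdiff_singleton, Set.insert_eq_of_mem (by exact hlB)]; exact hB
    · refine M.closure_subset_closure ?_ (hF hkF)
      rintro t ⟨h1, h2⟩
      refine ⟨h1, ?_⟩
      rintro rfl
      exact hl h2
    · intro h
      exact hcl (M.closure_subset_closure (by
        rintro t ⟨⟨h1, h2⟩, h3⟩
        exact ⟨h1, h3⟩) h)
    · have e1 : rpos q i ≠ rpos q k := fun h => hik (rpos_inj h)
      have e2 : rpos q i ≠ rpos q l := fun h => hli (rpos_inj h)
      have e3 : rpos q k ≠ rpos q l := fun h => hkl (rpos_inj h)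
      have e4 : rpos q i ≠ rpos q z := fun h => hiz (rpos_inj h)
      have e5 : rpos q k ≠ rpos q z := fun h => hkz (rpos_inj h)
      -- classify
      have main : ∀ a b : Fin n, btw a → ¬ btw b → rpos q i ≠ rpos q b → rpos q k ≠ rpos q b →
          Cross k i a b := by
        intro a b ha hb' n1 n2
        rw [hbtw] at ha hb'
        rcases ha with ha | ha
        · rcases lt_or_ge (rpos q b) (rpos q i) with h | h
          · exact Or.inr (cyc4_of_rpos h ha.1 ha.2).rot.rot.rot
          · exact Or.inr (cyc4_of_rpos ha.1 ha.2 (show rpos q k < rpos q b by omega)).rot.rot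
        · rcases lt_or_ge (rpos q b) (rpos q k) with h | h
          · exact Or.inl (cyc4_of_rpos h ha.1 ha.2).rot
          · exact Or.inl (cyc4_of_rpos ha.1 ha.2 (show rpos q i < rpos q b by omega))
      by_cases hzb : btw z
      · exact (main z l hzb (hb.1 hzb) e2 e3).symm
      · have : btw l := by_contra fun h => hzb (hb.2 h)
        exact main l z this hzb e4 e5
  have tight1 : (F1 : Set (Fin n)) ⊆ M.closure (↑B ∩ ↑F1) := by
    intro z hz
    by_cases hzF : z ∈ F
    · exact M.closure_subset_closure (by
        rintro t ⟨h1, h2⟩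
        exact ⟨h1, by simp [hF1]; exact Or.inl h2⟩) (hF hzF)
    · have hzb : btw z := by
        have : z ∈ F1 := hz
        simp only [hF1, Finset.mem_union, Finset.mem_filter, Finset.mem_univ, true_and] at this
        tauto
      by_contra hcon
      obtain ⟨l, hl, hlF, hlcl⟩ := exists_fund_of_notMem hB.indep (hBcl z) hcon
      have hl' : l ∉ F ∧ ¬ btw l := by
        have : l ∉ F1 := hlF
        simp only [hF1, Finset.mem_union, Finset.mem_filter, Finset.mem_univ, true_and] at this
        tauto
      exact key z l hzF hl'.1 hl hlcl (by tauto)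
  have tight2 : (F2 : Set (Fin n)) ⊆ M.closure (↑B ∩ ↑F2) := by
    intro z hz
    by_cases hzF : z ∈ F
    · exact M.closure_subset_closure (by
        rintro t ⟨h1, h2⟩
        exact ⟨h1, by simp [hF2]; exact Or.inl h2⟩) (hF hzF)
    · have hzb : ¬ btw z := by
        have : z ∈ F2 := hz
        simp only [hF2, Finset.mem_union, Finset.mem_filter, Finset.mem_univ, true_and] at this
        tauto
      by_contra hcon
      obtain ⟨l, hl, hlF, hlcl⟩ := exists_fund_of_notMem hB.indep (hBcl z) hcon
      have hl' : l ∉ F ∧ btw l := by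
        have : l ∉ F2 := hlF
        simp only [hF2, Finset.mem_union, Finset.mem_filter, Finset.mem_univ, true_and] at this
        tauto
      exact key z l hzF hl'.1 hl hlcl (by tauto)
  have c1 : (F1ᶜ).card < m := by
    rw [← hm]
    apply Finset.card_lt_card
    refine ⟨Finset.compl_subset_compl.2 Finset.subset_union_left, fun h => ?_⟩
    have := h (Finset.mem_compl.2 hwF)
    simp only [hF1, Finset.mem_compl, Finset.mem_union, Finset.mem_filter, Finset.mem_univ,
      true_and] at this
    exact this (Or.inr ((hbtw w).2 hw))
  have c2 : (F2ᶜ).card < m := by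
    rw [← hm]
    apply Finset.card_lt_card
    refine ⟨Finset.compl_subset_compl.2 Finset.subset_union_left, fun h => ?_⟩
    have := h (Finset.mem_compl.2 hq)
    simp only [hF2, Finset.mem_compl, Finset.mem_union, Finset.mem_filter, Finset.mem_univ,
      true_and] at this
    exact this (Or.inr hqb)
  have r1 := ih _ c1 F1 rfl tight1
  have r2 := ih _ c2 F2 rfl tight2
  have hU : F1 ∪ F2 = Finset.univ := by
    ext z
    simp only [hF1, hF2, Finset.mem_union, Finset.mem_filter, Finset.mem_univ, true_and]
    tauto
  have hI : F1 ∩ F2 = F := by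
    ext z
    simp only [hF1, hF2, Finset.mem_union, Finset.mem_inter, Finset.mem_filter, Finset.mem_univ,
      true_and]
    tauto
  have s1 := Finset.sum_union_inter (s₁ := F1) (s₂ := F2) (f := y)
  rw [hU, hI, hsum] at s1
  have s2 := Finset.card_union_add_card_inter (B ∩ F1) (B ∩ F2)
  have e1 : B ∩ F1 ∪ B ∩ F2 = B := by
    rw [← Finset.inter_union_distrib_left, hU, Finset.inter_univ]
  have e2 : B ∩ F1 ∩ (B ∩ F2) = B ∩ F := by
    rw [← Finset.inter_inter_distrib_left, hI]
  rw [e1, e2] at s2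
  have s3 : (B.card : ℝ) + ((B ∩ F).card : ℝ) = ((B ∩ F1).card : ℝ) + ((B ∩ F2).card : ℝ) := by
    exact_mod_cast s2
  linarith

theorem abel_ineq {α : Type*} [Fintype α] (w g : α → ℝ) :
    ∀ F : Finset α, (∀ G ⊆ F, (∀ z ∈ G, ∀ z' ∈ F, w z ≤ w z' → z' ∈ G) → ∑ z ∈ G, g z ≤ 0) →
      ∀ c : ℝ, (∀ z ∈ F, c ≤ w z) → ∑ z ∈ F, w z * g z ≤ c * ∑ z ∈ F, g z := by
  classical
  intro F
  induction F using Finset.strongInduction with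
  | H F ih =>
  intro hG c hc
  rcases F.eq_empty_or_nonempty with rfl | hne
  · simp
  obtain ⟨m, hmF, hm⟩ := Finset.exists_min_image F w hne
  set F' := F.filter (fun z => w m < w z) with hF'
  have hss : F' ⊂ F := by
    refine ⟨Finset.filter_subset _ _, fun h => ?_⟩
    have := h hmF
    simp [hF'] at this
  have h1 := ih F' hss (by
    intro G hGF hup
    refine hG G (hGF.trans hss.1) fun z hz z' hz' hle => ?_
    refine hup z hz z' ?_ hle
    have := hGF hz
    simp only [hF', Finset.mem_filter] at this ⊢
    exact ⟨hz', lt_of_lt_of_le this.2 hle⟩) (w m) (by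
      intro z hz
      simp only [hF', Finset.mem_filter] at hz
      exact hz.2.le)
  have h2 : ∑ z ∈ F \ F', w z * g z = w m * ∑ z ∈ F \ F', g z := by
    rw [Finset.mul_sum]
    refine Finset.sum_congr rfl fun z hz => ?_
    simp only [hF', Finset.mem_sdiff, Finset.mem_filter, not_and, not_lt] at hz
    rw [le_antisymm (hz.2 hz.1) (hm z hz.1)]
  have h3 := Finset.sum_sdiff hss.1 (f := fun z => w z * g z)
  have h4 := Finset.sum_sdiff hss.1 (f := g)
  have h5 : ∑ z ∈ F, g z ≤ 0 := hG F subset_rfl fun _ _ z' hz' _ => hz'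
  have h6 := hc m hmF
  have h7 := mul_le_mul_of_nonpos_right h6 h5
  have h8 : w m * ∑ z ∈ F, g z = w m * ∑ z ∈ F \ F', g z + w m * ∑ z ∈ F', g z := by
    rw [← h4, mul_add]
  linarith

theorem base_ncard {n : ℕ} {M : Matroid (Fin n)} {B B' : Finset (Fin n)} (h : M.IsBase ↑B)
    (h' : M.IsBase ↑B') : B.card = B'.card := by
  have := h.ncard_eq_ncard_of_isBase h'
  simpa using this

/-- The polytope of a noncrossing matroid. -/
theorem polytope_of_NC {n : ℕ} (M : Matroid (Fin n)) (hE : M.E = Set.univ) (hNC : NC M) (d : ℕ)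
    (hd : ∀ B : Finset (Fin n), M.IsBase ↑B → B.card = d) :
    matroidPolytope (fun B : Finset (Fin n) => M.IsBase ↑B) =
          {x : Fin n → ℝ | (∑ i, x i) = (d : ℝ) ∧
            ∀ i j : Fin n, ∑ ℓ ∈ cycInt i j, x ℓ ≤ ((M.eRk (cycInt i j : Set (Fin n))).toNat : ℝ)} := by
  apply Set.Subset.antisymm
  · apply convexHull_min
    · rintro x ⟨B, hB, rfl⟩
      refine ⟨by simp [hd B hB], fun i j => ?_⟩
      rw [Finset.sum_ite_mem]
      simp only [Finset.sum_const, nsmul_eq_mul, mul_one]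
      rw [Finset.inter_comm]
      exact_mod_cast card_le_rk hB.indep
    · intro x hx y hy a b ha hb hab
      refine ⟨?_, fun i j => ?_⟩
      · simp only [Pi.add_apply, Pi.smul_apply, smul_eq_mul, Finset.sum_add_distrib,
          ← Finset.mul_sum, hx.1, hy.1]
        rw [← add_mul, hab, one_mul]
      · simp only [Pi.add_apply, Pi.smul_apply, smul_eq_mul, Finset.sum_add_distrib,
          ← Finset.mul_sum]
        have h1 := mul_le_mul_of_nonneg_left (hx.2 i j) ha
        have h2 := mul_le_mul_of_nonneg_left (hy.2 i j) hb
        calc _ ≤ _ := add_le_add h1 h2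
          _ = _ := by rw [← add_mul, hab, one_mul]
  · rintro y ⟨hsum, hy⟩
    by_contra hcon
    have hfin : {x : Fin n → ℝ | ∃ B : Finset (Fin n), M.IsBase ↑B ∧
        x = fun i => if i ∈ B then (1 : ℝ) else 0}.Finite := by
      apply (Set.finite_range (fun B : Finset (Fin n) =>
        (fun i => if i ∈ B then (1 : ℝ) else 0 : Fin n → ℝ))).subset
      rintro x ⟨B, _, rfl⟩
      exact ⟨B, rfl⟩
    obtain ⟨f, u, hf, hu⟩ := geometric_hahn_banach_closed_point
      (convex_convexHull ℝ _) (hfin.isClosed_convexHull ℝ) hcon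
    set w : Fin n → ℝ := fun i => f (Pi.single i 1) with hw
    have hfw : ∀ x : Fin n → ℝ, f x = ∑ i, w i * x i := by
      intro x
      conv_lhs => rw [pi_eq_sum_univ' x]
      rw [map_sum]
      refine Finset.sum_congr rfl fun i _ => ?_
      rw [map_smul, smul_eq_mul, mul_comm]
      
    obtain ⟨B0, hB0⟩ := M.exists_isBase
    classical
    obtain ⟨B, hB, hmax⟩ := Finset.exists_max_image
      (Finset.univ.filter fun B : Finset (Fin n) => M.IsBase ↑B) (fun B => ∑ z ∈ B, w z)
      ⟨B0.toFinset, by simpa using hB0⟩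
    simp only [Finset.mem_filter, Finset.mem_univ, true_and] at hB hmax
    have hcard := hd B hB
    have h1 : f (fun i => if i ∈ B then (1 : ℝ) else 0) < u :=
      hf _ (subset_convexHull ℝ _ ⟨B, hB, rfl⟩)
    have h2 : ∑ i, w i * (y i - if i ∈ B then (1 : ℝ) else 0) ≤ 0 := by
      rcases isEmpty_or_nonempty (Fin n) with hem | hne
      · simp
      obtain ⟨m, -, hm⟩ := Finset.exists_min_image Finset.univ w Finset.univ_nonempty
      have := abel_ineq w (fun i => y i - if i ∈ B then (1 : ℝ) else 0) Finset.univ (by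
        intro G _ hup
        have ht : (G : Set (Fin n)) ⊆ M.closure (↑B ∩ ↑G) := by
          intro z hz
          by_contra hc
          obtain ⟨l, hl, hlG, hlcl⟩ := exists_fund_of_notMem hB.indep
            (by rw [hB.closure_eq, hE]; trivial) hc
          have hb := hB.exchange_base_of_notMem_closure (e := l) (f := z) hl hlcl (by simp [hE])
          have hzl : z ∉ (B : Set (Fin n)) \ {l} := by
            intro h
            exact hlcl (M.mem_closure_of_mem' h (by simp [hE]))
          have := hmax (insert z (B.erase l)) (by simpa using hb)
          rw [Finset.sum_insert (by simpa [and_comm] using hzl)] at this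
          have h3 := Finset.add_sum_erase B w hl
          exact hlG (hup z hz l (Finset.mem_univ _) (by linarith))
        have := poly_core M hE hNC B hB y (by rw [hsum, hcard]) hy G ht
        rw [Finset.sum_sub_distrib, Finset.sum_ite_mem]
        simp only [Finset.sum_const, nsmul_eq_mul, mul_one]
        rw [Finset.inter_comm G B]
        linarith) (w m) (fun z _ => hm z (Finset.mem_univ _))
      refine this.trans ?_
      rw [Finset.sum_sub_distrib, hsum]
      simp [hcard]
    rw [hfw] at h1 hu
    simp only [mul_sub, Finset.sum_sub_distrib] at h2
    linarith


/-! ## Closure helpers -/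

theorem cl_mem {α : Type*} {M : Matroid α} (hE : M.E = Set.univ) {X : Set α} {z : α} (h : z ∈ X) :
    z ∈ M.closure X := M.mem_closure_of_mem' h (by simp [hE])

theorem cl_sub {α : Type*} {M : Matroid α} {X Y : Set α} {z : α} (h : X ⊆ M.closure Y)
    (hz : z ∈ M.closure X) : z ∈ M.closure Y :=
  M.closure_subset_closure_of_subset_closure h hz

theorem cl_mono {α : Type*} {M : Matroid α} {X Y : Set α} {z : α} (h : X ⊆ Y)
    (hz : z ∈ M.closure X) : z ∈ M.closure Y :=
  M.closure_subset_closure h hz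

theorem cl_ex {α : Type*} {M : Matroid α} {X : Set α} {e f : α} (h : e ∈ M.closure (insert f X))
    (h' : e ∉ M.closure X) : f ∈ M.closure (insert e X) :=
  (M.closure_exchange ⟨h, h'⟩).1

theorem cl_ins {α : Type*} {M : Matroid α} {X Y : Set α} {f : α} (hf : f ∈ M.closure Y)
    (h : X ⊆ M.closure Y) : insert f X ⊆ M.closure Y := by
  rintro z (rfl | hz)
  · exact hf
  · exact h hz

theorem cl_base {α : Type*} {M : Matroid α} (hE : M.E = Set.univ) {B : Set α} (hB : M.IsBase B)
    (z : α) : z ∈ M.closure B := by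
  rw [hB.closure_eq, hE]; trivial

/-- Elements which are neither loops nor coloops. -/
def Free {α : Type*} (M : Matroid α) (z : α) : Prop :=
  z ∉ M.closure ∅ ∧ z ∈ M.closure {z}ᶜ

theorem free_mk {α : Type*} {M : Matroid α} {T R : Set α} {z : α} (h1 : z ∉ M.closure T)
    (h2 : z ∈ M.closure R) (h3 : z ∉ R) : Free M z :=
  ⟨fun h => h1 (cl_mono (Set.empty_subset _) h),
    cl_mono (fun w hw => by
      rintro rfl
      exact h3 hw) h2⟩

theorem free_of_fund {α : Type*} {M : Matroid α} {I : Set α} {l k : α}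
    (hI : M.Indep I) (hl : l ∈ I) (hk : k ∈ M.closure I) (hk' : k ∉ M.closure (I \ {l}))
    (hne : k ≠ l) : Free M l := by
  refine free_mk (hI.notMem_closure_sdiff_of_mem hl) (R := insert k (I \ {l})) ?_ ?_
  · refine cl_ex ?_ hk'
    rw [Set.insert_sdiff_singleton, Set.insert_eq_of_mem hl]
    exact hk
  · rintro (h | h)
    · exact hne h.symm
    · exact h.2 rfl

/-- The data of a bridge. -/
structure BD {n : ℕ} (M : Matroid (Fin n)) (x y j : Fin n) : Prop where
  hE : M.E = Set.univ
  nc : NC M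
  fx : Free M x
  fy : Free M y
  fj : Free M j
  xy : x < y
  yj : y ≤ j
  next : ∀ z, Free M z → x < z → y ≤ z
  ind : M.Indep {z | Free M z ∧ x < z}
  xcl : x ∈ M.closure {z | Free M z ∧ x < z ∧ z ≤ j}
  min : x ∉ M.closure {z | Free M z ∧ x < z ∧ z < j}

/-- The free elements strictly after `y`, up to `j`. -/
def SS {n : ℕ} (M : Matroid (Fin n)) (y j : Fin n) : Set (Fin n) := {z | Free M z ∧ y < z ∧ z ≤ j}

namespace BD

variable {n : ℕ} {M : Matroid (Fin n)} {x y j : Fin n}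

theorem out (D : BD M x y j) {l : Fin n} (hl : Free M l) (h1 : l ∉ SS M y j) (h2 : l ≠ x)
    (h3 : l ≠ y) : l < x ∨ j < l := by
  by_contra hcon
  push Not at hcon
  have h4 : x < l := lt_of_le_of_ne hcon.1 (Ne.symm h2)
  have h5 := D.next l hl h4
  exact h1 ⟨hl, lt_of_le_of_ne h5 (Ne.symm h3), hcon.2⟩

theorem xin (D : BD M x y j) : x ∈ M.closure (insert y (SS M y j)) := by
  refine cl_mono ?_ D.xcl
  rintro z ⟨h1, h2, h3⟩
  rcases eq_or_lt_of_le (D.next z h1 h2) with h | h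
  · exact Or.inl h.symm
  · exact Or.inr ⟨h1, h, h3⟩

theorem insInd (D : BD M x y j) : M.Indep (insert y (SS M y j)) := by
  refine D.ind.subset ?_
  rintro z (rfl | hz)
  · exact ⟨D.fy, D.xy⟩
  · exact ⟨hz.1, D.xy.trans hz.2.1⟩

theorem yS (_ : BD M x y j) : y ∉ SS M y j := fun h => lt_irrefl _ h.2.1

theorem xS (D : BD M x y j) : x ∉ SS M y j := fun h => lt_asymm D.xy h.2.1

theorem ynot (D : BD M x y j) : y ∉ M.closure (SS M y j) := by
  have := D.insInd.notMem_closure_sdiff_of_mem (e := y) (by simp)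
  simpa [D.yS] using this

theorem xnot (D : BD M x y j) : x ∉ M.closure (SS M y j) := by
  intro hx
  have hyj : y < j := by
    refine lt_of_le_of_ne D.yj ?_
    intro h
    apply D.fx.1
    refine cl_mono ?_ hx
    rintro z ⟨_, h1, h2⟩
    rw [h] at h1
    exact absurd (lt_of_lt_of_le h1 h2) (lt_irrefl _)
  obtain ⟨B, hB, hBs⟩ := D.insInd.exists_isBase_superset
  have hyB : y ∈ B := hBs (by simp)
  have hB' : insert y (B \ {y}) = B := by
    rw [Set.insert_sdiff_singleton, Set.insert_eq_of_mem hyB]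
  have hST : SS M y j ⊆ B \ {y} := fun z hz => ⟨hBs (Or.inr hz), fun h => by
    have h' : z = y := h
    rw [h'] at hz; exact D.yS hz⟩
  have hyT : y ∉ M.closure (B \ {y}) := hB.indep.notMem_closure_sdiff_of_mem hyB
  obtain ⟨l, hly, hl⟩ : ∃ l, l ≠ y ∧ l ∉ M.closure (B \ {y}) := by
    by_contra hcon
    push Not at hcon
    exact hyT (cl_sub (fun z hz => hcon z hz) D.fy.2)
  have hlB : l ∉ B := fun h => hl (cl_mem D.hE ⟨h, hly⟩)
  have hlf : Free M l := free_mk hl (cl_base D.hE hB l) hlB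
  have hlo := D.out hlf (fun h => hlB (hBs (Or.inr h))) (by
    rintro rfl
    exact hl (cl_mono hST hx)) hly
  have hxj : x ∉ M.closure ((B \ {y}) \ {j}) := by
    intro h
    have h1 : M.Indep (SS M y j ∪ (B \ {y}) \ {j}) := hB.indep.subset (by
      rintro z (hz | hz)
      · exact (hST hz).1
      · exact hz.1.1)
    have h2 : x ∈ M.closure (SS M y j ∩ ((B \ {y}) \ {j})) := by
      rw [h1.closure_inter_eq_inter_closure]
      exact ⟨hx, h⟩
    refine D.min (cl_mono ?_ h2)
    rintro z ⟨h3, h4⟩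
    exact ⟨h3.1, D.xy.trans h3.2.1, lt_of_le_of_ne h3.2.2 h4.2⟩
  refine D.nc (B \ {y}) j x y l (by rw [hB']; exact hB) (by simp) hl
    (hST ⟨D.fj, hyj, le_refl _⟩) (cl_mono hST hx) hxj ?_
  have := D.xy
  unfold Cross Cyc4
  simp only [Fin.lt_def] at *
  omega

theorem yin (D : BD M x y j) : y ∈ M.closure (insert x (SS M y j)) := cl_ex D.xin D.xnot

theorem xofy (D : BD M x y j) {X : Set (Fin n)} (hS : SS M y j ⊆ M.closure X)
    (hy : y ∈ M.closure X) : x ∈ M.closure X := cl_sub (cl_ins hy hS) D.xin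

theorem yofx (D : BD M x y j) {X : Set (Fin n)} (hS : SS M y j ⊆ M.closure X)
    (hx : x ∈ M.closure X) : y ∈ M.closure X := cl_sub (cl_ins hx hS) D.yin

theorem shift (D : BD M x y j) {K : Set (Fin n)} (hK : M.IsBase K) (hx : x ∈ K) (hy : y ∉ K) :
    M.IsBase (insert y (K \ {x})) := by
  have hK' : insert x (K \ {x}) = K := by
    rw [Set.insert_sdiff_singleton, Set.insert_eq_of_mem hx]
  have hxT : x ∉ M.closure (K \ {x}) := hK.indep.notMem_closure_sdiff_of_mem hx
  refine base_swap D.hE (p := x) (by rw [hK']; exact hK) (by simp) ?_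
  intro hyc
  obtain ⟨k, hkS, hk⟩ : ∃ k ∈ SS M y j, k ∉ M.closure (K \ {x}) := by
    by_contra hcon
    push Not at hcon
    exact hxT (D.xofy hcon hyc)
  have hTi : M.Indep (K \ {x}) := hK.indep.subset Set.sdiff_subset
  obtain ⟨l, hlT, hlS, hl⟩ := exists_fund_of_notMem hTi hyc (G := SS M y j)
    (fun h => D.ynot (cl_mono Set.inter_subset_right h))
  have hyl : y ≠ l := by
    rintro rfl
    exact hy hlT.1
  have hlf := free_of_fund hTi hlT hyc hl hyl
  have hlo := D.out hlf hlS hlT.2 hyl.symm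
  refine D.nc (K \ {x}) l y x k (by rw [hK']; exact hK) (by simp) hk hlT hyc hl ?_
  have := D.xy
  have := hkS.2
  unfold Cross Cyc4
  simp only [Fin.lt_def, Fin.le_def] at *
  omega

end BD

/-- The bases lost by undoing the bridge. -/
def Bad {n : ℕ} (M : Matroid (Fin n)) (x y j : Fin n) (I : Set (Fin n)) : Prop :=
  y ∈ I ∧ x ∉ I ∧ SS M y j ⊆ M.closure (I \ {y})

/-- The bases remaining after undoing the bridge. -/
def Good {n : ℕ} (M : Matroid (Fin n)) (x y j : Fin n) (I : Set (Fin n)) : Prop :=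
  M.IsBase I ∧ ¬ Bad M x y j I

namespace BD

variable {n : ℕ} {M : Matroid (Fin n)} {x y j : Fin n}

theorem bad_swap (D : BD M x y j) {I : Set (Fin n)} (hI : M.IsBase I) (hb : Bad M x y j I) :
    Good M x y j (insert x (I \ {y})) := by
  have hyT : y ∉ M.closure (I \ {y}) := hI.indep.notMem_closure_sdiff_of_mem hb.1
  have hI' : insert y (I \ {y}) = I := by
    rw [Set.insert_sdiff_singleton, Set.insert_eq_of_mem hb.1]
  refine ⟨base_swap D.hE (p := y) (by rw [hI']; exact hI) (by simp) ?_, ?_⟩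
  · intro h
    exact hyT (D.yofx hb.2.2 h)
  · rintro ⟨h, -⟩
    rcases h with h | h
    · exact absurd h (ne_of_gt D.xy)
    · exact h.2 rfl

theorem bridge (D : BD M x y j) (I : Set (Fin n)) :
    M.IsBase I ↔ Good M x y j I ∨
      (y ∈ I ∧ x ∉ I ∧ Good M x y j (insert x (I \ {y}))) := by
  constructor
  · intro h
    by_cases hb : Bad M x y j I
    · exact Or.inr ⟨hb.1, hb.2.1, D.bad_swap h hb⟩
    · exact Or.inl ⟨h, hb⟩
  · rintro (h | ⟨h1, h2, h3⟩)
    · exact h.1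
    · have h4 := D.shift h3.1 (by simp) (by
        rintro (h | h)
        · exact absurd h (ne_of_gt D.xy)
        · exact h.2 rfl)
      have : insert y (insert x (I \ {y}) \ {x}) = I := by
        ext z
        simp only [Set.mem_insert_iff, Set.mem_sdiff, Set.mem_singleton_iff]
        constructor
        · rintro (rfl | ⟨(h | h), h'⟩)
          · exact h1
          · exact absurd h h'
          · exact h.1
        · intro hz
          by_cases hzy : z = y
          · exact Or.inl hzy
          · refine Or.inr ⟨Or.inr ⟨hz, hzy⟩, ?_⟩
            rintro rfl
            exact h2 hz
      rwa [this] at h4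

theorem good_exists (D : BD M x y j) : ∃ B, Good M x y j B := by
  obtain ⟨B, hB⟩ := M.exists_isBase
  by_cases hb : Bad M x y j B
  · exact ⟨_, D.bad_swap hB hb⟩
  · exact ⟨B, hB, hb⟩

theorem bad_exists (D : BD M x y j) : ∃ B, M.IsBase B ∧ Bad M x y j B := by
  obtain ⟨B, hB, hBs⟩ := D.insInd.exists_isBase_superset
  have hyB : y ∈ B := hBs (by simp)
  have hST : SS M y j ⊆ B \ {y} := fun z hz => ⟨hBs (Or.inr hz), fun h => by
    have h' : z = y := h
    rw [h'] at hz; exact D.yS hz⟩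
  have hSc : SS M y j ⊆ M.closure (B \ {y}) := fun z hz => cl_mem D.hE (hST hz)
  refine ⟨B, hB, hyB, fun hx => ?_, hSc⟩
  exact hB.indep.notMem_closure_sdiff_of_mem hyB
    (D.yofx hSc (cl_mem D.hE ⟨hx, ne_of_lt D.xy⟩))

/-- If `B` is a base containing `y`, `B \ y ⊆ cl X`, `y ∉ cl X`, then `cl X ⊆ cl (B \ y)`. -/
theorem span_of (_ : BD M x y j) {B X : Set (Fin n)} {k : Fin n} (hk : k ∈ M.closure B)
    (hyB : y ∈ B)
    (h : B \ {y} ⊆ M.closure X) (hy : y ∉ M.closure X) (hkX : k ∈ M.closure X) :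
    k ∈ M.closure (B \ {y}) := by
  by_contra hcon
  have h1 : k ∈ M.closure (insert y (B \ {y})) := by
    rw [Set.insert_sdiff_singleton, Set.insert_eq_of_mem hyB]
    exact hk
  exact hy (cl_sub (cl_ins hkX h) (cl_ex h1 hcon))

end BD


namespace BD

variable {n : ℕ} {M : Matroid (Fin n)} {x y j : Fin n}

/-- Final case of the exchange property. -/
theorem exch_last (D : BD M x y j) {T0 : Set (Fin n)} {s b : Fin n}
    (hyT0 : y ∉ T0) (hxT : x ∈ M.closure (insert y T0)) (hsS : s ∈ SS M y j)
    (hbase : M.IsBase (insert y (insert s T0))) (hyH : y ∉ M.closure (insert s T0))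
    (hS : SS M y j ⊆ M.closure (insert s T0))
    (hsT : s ∉ M.closure (insert y T0))
    (hbT : b ∉ M.closure (insert y T0)) (hsK : s ∉ M.closure (insert b T0)) : False := by
  have hE := D.hE
  have hs0 : s ∉ M.closure T0 := fun h => hsK (cl_mono (Set.subset_insert _ _) h)
  have hb0 : b ∉ M.closure T0 := fun h => hbT (cl_mono (Set.subset_insert _ _) h)
  have hbH : b ∉ M.closure (insert s T0) := fun h => hsK (cl_ex h hb0)
  have hbS : b ∉ SS M y j := fun h => hbH (hS h)
  have hxH : x ∉ M.closure (insert s T0) := fun h => hyH (D.yofx hS h)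
  have hx0 : x ∉ M.closure T0 := fun h => hxH (cl_mono (Set.subset_insert _ _) h)
  have hby : b ≠ y := by rintro rfl; exact hbT (cl_mem hE (Or.inl rfl))
  have hbx : b ≠ x := by rintro rfl; exact hbT hxT
  have hys : y ∉ insert s T0 := fun h => hyH (cl_mem hE h)
  have hbf : Free M b := free_mk hbT (cl_base hE hbase b) (by
    rintro (h | h)
    · exact hby h
    · exact hbH (cl_mem hE h))
  have hbo := D.out hbf hbS hbx hby
  have hxy := D.xy
  have hsS' := hsS.2
  set G : Set (Fin n) := {z | rpos y z < rpos y b} with hG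
  have hI1 : M.Indep (insert s T0) := hbase.indep.subset (Set.subset_insert _ _)
  have ha : SS M y j ⊆ M.closure (insert s T0 ∩ G) := by
    intro p hp
    by_contra hcon
    obtain ⟨t, ht, htG, htc⟩ := exists_fund_of_notMem hI1 (hS hp) hcon
    have htb : rpos y b ≠ rpos y t := by
      intro h
      have := rpos_inj h
      rw [← this] at ht
      exact hbH (cl_mem hE ht)
    have htG' : ¬ (rpos y t < rpos y b) := htG
    refine D.nc (insert s T0) t p y b hbase hys hbH ht (hS hp) htc ?_
    refine Or.inr (cyc4_of_rpos (q := y) (a := y) (b := p) (c := b) (d := t) ?_ ?_ (by omega)).rot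
    · have := hp.2
      unfold rpos
      simp only [Fin.lt_def, Fin.le_def] at *
      split_ifs <;> omega
    · have := hp.2
      have := b.isLt
      unfold rpos
      simp only [Fin.lt_def, Fin.le_def] at *
      split_ifs <;> omega
  have hxG : x ∈ M.closure (insert y (T0 ∩ G)) := by
    have h1 : x ∈ M.closure (insert y (insert s T0 ∩ G)) := by
      refine D.xofy (fun z hz => cl_mono (Set.subset_insert _ _) (ha hz)) (cl_mem hE (Or.inl rfl))
    have h2 : M.Indep (insert y (insert s T0 ∩ G) ∪ insert y T0) := hbase.indep.subset (by
      rintro z ((rfl | hz) | (rfl | hz))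
      · exact Or.inl rfl
      · exact Or.inr hz.1
      · exact Or.inl rfl
      · exact Or.inr (Or.inr hz))
    have h3 : x ∈ M.closure (insert y (insert s T0 ∩ G) ∩ insert y T0) := by
      rw [h2.closure_inter_eq_inter_closure]
      exact ⟨h1, hxT⟩
    refine cl_mono ?_ h3
    rintro z ⟨h4, h5⟩
    rcases h5 with rfl | h5
    · exact Or.inl rfl
    · rcases h4 with rfl | h4
      · exact Or.inl rfl
      · exact Or.inr ⟨h5, h4.2⟩
  have hI2 : M.Indep (insert y T0) := hbase.indep.subset
    (Set.insert_subset_insert (Set.subset_insert _ _))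
  have hbase2 : M.IsBase (insert x (insert s T0)) := base_swap hE hbase hys hxH
  have hyx : y ∈ M.closure (insert x T0) := cl_ex hxT hx0
  have hclx : ∀ z, z ∈ M.closure (insert x T0) → z ∈ M.closure (insert y T0) := fun z hz =>
    cl_sub (cl_ins hxT (fun w hw => cl_mem hE (Or.inr hw))) hz
  have hfin : x ∈ M.closure (insert y T0 ∩ {z | Free M z ∧ x < z ∧ z < j}) := by
    refine fund_mem_closure hI2 hxT fun i hi hic => ?_
    by_cases hiy : i = y
    · rw [hiy]
      exact ⟨D.fy, D.xy, lt_of_lt_of_le hsS.2.1 hsS.2.2⟩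
    have hi0 : i ∈ T0 := by
      rcases hi with h | h
      · exact absurd h hiy
      · exact h
    have hxi : x ≠ i := by
      rintro rfl
      exact hx0 (cl_mem hE hi0)
    have hif : Free M i := free_of_fund hI2 hi hxT hic hxi
    have hiG : rpos y i < rpos y b := by
      by_contra h
      refine hic (cl_mono ?_ hxG)
      rintro z (rfl | hz)
      · exact ⟨Or.inl rfl, fun h => hiy h.symm⟩
      · refine ⟨Or.inr hz.1, fun h' => ?_⟩
        have h' : z = i := h'
        rw [h'] at hz
        exact h hz.2
    have his : i ≠ s := by
      rintro rfl
      exact hs0 (cl_mem hE hi0)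
    have hib : i ≠ b := by
      rintro rfl
      exact hb0 (cl_mem hE hi0)
    rcases lt_or_ge (rpos y i) (rpos y s) with h | h
    · refine ⟨hif, ?_⟩
      have h1 := i.isLt
      have h2 : i.val ≠ y.val := fun h => hiy (Fin.ext h)
      unfold rpos at h
      simp only [Fin.lt_def, Fin.le_def] at *
      split_ifs at h <;> omega
    · exfalso
      have h' : rpos y s < rpos y i := lt_of_le_of_ne h (fun h => his (rpos_inj h.symm))
      refine D.nc (insert x T0) i y s b ?_ ?_ ?_ (Or.inr hi0) hyx ?_ ?_
      · rw [Set.insert_comm]; exact hbase2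
      · intro h
        exact hsT (hclx s (cl_mem hE h))
      · intro h
        exact hbT (hclx b h)
      · intro h
        have e1 : insert x T0 \ {i} = insert x (T0 \ {i}) := by
          rw [Set.insert_sdiff_of_notMem]; simpa using hxi
        have e2 : insert y T0 \ {i} = insert y (T0 \ {i}) := by
          rw [Set.insert_sdiff_of_notMem]; simpa using Ne.symm hiy
        rw [e1] at h
        rw [e2] at hic
        refine hic (cl_ex h ?_)
        intro hc
        exact hyH (cl_mono (fun z hz => Or.inr hz.1) hc)
      · refine Or.inl (cyc4_of_rpos (q := y) ?_ h' hiG)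
        unfold rpos
        simp only [Fin.lt_def, Fin.le_def] at *
        split_ifs <;> omega
  exact D.min (cl_mono Set.inter_subset_right hfin)

theorem exch (D : BD M x y j) {B1 B2 : Set (Fin n)} (h1 : Good M x y j B1) (h2 : Good M x y j B2)
    {b1 : Fin n} (hb1 : b1 ∈ B1) (hb2 : b1 ∉ B2) :
    ∃ c ∈ B2, c ∉ B1 ∧ Good M x y j (insert c (B1 \ {b1})) := by
  have hE := D.hE
  by_contra hcon
  push Not at hcon
  set T := B1 \ {b1} with hT
  have hB1 : insert b1 T = B1 := by
    rw [hT, Set.insert_sdiff_singleton, Set.insert_eq_of_mem hb1]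
  have hb1T : b1 ∉ M.closure T := h1.1.indep.notMem_closure_sdiff_of_mem hb1
  have hb1T' : b1 ∉ T := fun h => hb1T (cl_mem hE h)
  have hsw : ∀ c, c ∉ M.closure T → M.IsBase (insert c T) := fun c hc =>
    base_swap hE (p := b1) (by rw [hB1]; exact h1.1) hb1T' hc
  have hbad : ∀ c ∈ B2, c ∉ M.closure T → Bad M x y j (insert c T) := by
    intro c hc hcT
    have := hcon c hc (by
      rw [← hB1]
      rintro (rfl | h)
      · exact hb2 hc
      · exact hcT (cl_mem hE h))
    by_contra hh
    exact this ⟨hsw c hcT, hh⟩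
  obtain ⟨c0, hc0, hc0T⟩ : ∃ c ∈ B2, c ∉ M.closure T := by
    by_contra hc
    push Not at hc
    exact hb1T (cl_sub hc (cl_base hE h2.1 b1))
  by_cases hyT : y ∈ T
  · -- `y ∈ T`
    have hxT' : x ∉ T := fun h => (hbad c0 hc0 hc0T).2.1 (Or.inr h)
    set T0 := T \ {y} with hT0
    have hTT : insert y T0 = T := by
      rw [hT0, Set.insert_sdiff_singleton, Set.insert_eq_of_mem hyT]
    have hyT0 : y ∉ T0 := by simp [hT0]
    have hSc : ∀ c ∈ B2, c ∉ M.closure T → SS M y j ⊆ M.closure (insert c T0) := by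
      intro c hc hcT
      have h := (hbad c hc hcT).2.2
      have hcy : c ≠ y := by
        rintro rfl
        exact hcT (cl_mem hE hyT)
      have e : insert c T \ {y} = insert c T0 := by
        rw [Set.insert_sdiff_of_notMem]; simpa using hcy
      rwa [e] at h
    have hT0T : T0 ⊆ T := Set.sdiff_subset
    by_cases hSS : SS M y j ⊆ M.closure T0
    · have hxT : x ∈ M.closure T :=
        D.xofy (fun z hz => cl_mono hT0T (hSS hz)) (cl_mem hE hyT)
      apply h1.2
      refine ⟨hyT.1, ?_, fun z hz => cl_mono ?_ (hSS hz)⟩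
      · intro h
        have : x = b1 := by
          by_contra hne
          exact hxT' ⟨h, hne⟩
        rw [this] at hxT
        exact hb1T hxT
      · rintro w ⟨⟨h1, h2⟩, h3⟩
        exact ⟨h1, h3⟩
    obtain ⟨s, hsS, hs0⟩ := Set.not_subset.1 hSS
    -- generic facts about such an `s`
    have gen : ∀ s ∈ SS M y j, s ∉ M.closure T0 → SS M y j ⊆ M.closure (insert s T0) ∧
        (∀ c ∈ B2, c ∉ M.closure T → c ∈ M.closure (insert s T0)) ∧ s ∉ M.closure T ∧
        M.IsBase (insert y (insert s T0)) ∧ y ∉ M.closure (insert s T0) := by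
      intro s hsS hs0
      have hc : ∀ c ∈ B2, c ∉ M.closure T → c ∈ M.closure (insert s T0) := fun c hc hcT =>
        cl_ex (hSc c hc hcT hsS) hs0
      have hT0c : T0 ⊆ M.closure (insert s T0) := fun w hw => cl_mem hE (Or.inr hw)
      have hsT : s ∉ M.closure T := by
        intro h
        exact hc0T (cl_sub (cl_ins h (fun w hw => cl_mem hE (hT0T hw))) (hc c0 hc0 hc0T))
      have hbb : M.IsBase (insert y (insert s T0)) := by
        rw [Set.insert_comm, hTT]
        exact hsw s hsT
      refine ⟨fun z hz => cl_sub (cl_ins (hc c0 hc0 hc0T) hT0c) (hSc c0 hc0 hc0T hz), hc, hsT,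
        hbb, base_notMem_closure hbb ?_⟩
      rintro (h | h)
      · rw [← h] at hsS
        exact D.yS hsS
      · exact hyT0 h
    by_cases hxT : x ∈ M.closure T
    · have hb1x : b1 ≠ x := by
        rintro rfl
        exact hb1T hxT
      have hnb : ¬ SS M y j ⊆ M.closure (insert b1 T0) := by
        intro h
        apply h1.2
        refine ⟨hyT.1, ?_, ?_⟩
        · rw [← hB1]
          rintro (h | h)
          · exact hb1x h.symm
          · exact hxT' h
        · have e : B1 \ {y} = insert b1 T0 := by
            rw [← hB1, Set.insert_sdiff_of_notMem]
            intro h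
            have h : b1 = y := h
            rw [h] at hb1T'
            exact hb1T' hyT
          rw [e]; exact h
      obtain ⟨s', hsS', hsK⟩ := Set.not_subset.1 hnb
      obtain ⟨g1, g2, g3, g4, g5⟩ := gen s' hsS'
        (fun h => hsK (cl_mono (Set.subset_insert _ _) h))
      rw [← hTT] at hxT g3 hb1T
      exact D.exch_last hyT0 hxT hsS' g4 g5 g1 g3 hb1T hsK
    · obtain ⟨g1, g2, g3, g4, g5⟩ := gen s hsS hs0
      have hxH : x ∉ M.closure (insert s T0) := fun h => g5 (D.yofx g1 h)
      have hxB2 : x ∉ B2 := fun h => hxH (g2 x h hxT)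
      obtain ⟨b, hb, hby, hbH⟩ : ∃ b ∈ B2, b ≠ y ∧ b ∉ M.closure (insert s T0) := by
        by_contra hcc
        push Not at hcc
        have hyB2 : y ∈ B2 := by
          by_contra hyB
          refine g5 (cl_sub (fun z hz => hcc z hz ?_) (cl_base hE h2.1 y))
          rintro rfl
          exact hyB hz
        exact h2.2 ⟨hyB2, hxB2, fun k hk => D.span_of (cl_base hE h2.1 k) hyB2
          (fun z hz => hcc z hz.1 hz.2) g5 (g1 hk)⟩
      have hbT : b ∈ M.closure T := by
        by_contra h
        exact hbH (g2 b hb h)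
      have hb0 : b ∉ M.closure T0 := fun h => hbH (cl_mono (Set.subset_insert _ _) h)
      have hbT' : b ∉ T := by
        rw [← hTT]
        rintro (h | h)
        · exact hby h
        · exact hb0 (cl_mem hE h)
      have hbf : Free M b := free_mk hb0 hbT hbT'
      have hbo := D.out hbf (fun h => hbH (g1 h)) (by rintro rfl; exact hxT hbT) hby
      refine D.nc T y b x s (hsw x hxT) hxT' g3 hyT hbT hb0 ?_
      have := D.xy
      have := hsS.2
      unfold Cross Cyc4
      simp only [Fin.lt_def, Fin.le_def] at *
      omega
  · -- `y ∉ T`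
    have hcy : ∀ c ∈ B2, c ∉ M.closure T → c = y := by
      intro c hc hcT
      rcases (hbad c hc hcT).1 with h | h
      · exact h.symm
      · exact absurd h hyT
    have hc0y := hcy c0 hc0 hc0T
    rw [hc0y] at hc0 hc0T
    obtain ⟨-, k2, k3⟩ := hbad y hc0 hc0T
    have e : insert y T \ {y} = T := by simp [hyT]
    rw [e] at k3
    have hxT : x ∉ M.closure T := fun h => hc0T (D.yofx k3 h)
    apply h2.2
    refine ⟨hc0, fun h => ne_of_lt D.xy (hcy x h hxT), fun k hk => ?_⟩
    refine D.span_of (cl_base hE h2.1 k) hc0 (X := T) ?_ hc0T (k3 hk)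
    intro z hz
    by_contra h
    exact hz.2 (hcy z hz.1 h)

end BD

/-! ## The four-base version of the noncrossing condition -/

/-- Noncrossing condition in terms of bases. -/
def NC4 {n : ℕ} (P : Set (Fin n) → Prop) : Prop :=
  ∀ (U : Set (Fin n)) (s l p q : Fin n), s ∉ U → l ∉ U → p ∉ U → q ∉ U → Cross s l p q →
    P (insert l (insert p U)) → P (insert l (insert q U)) → P (insert s (insert p U)) →
    P (insert s (insert q U)) → P (insert s (insert l U))

theorem Cross.ne {n : ℕ} {s l p q : Fin n} (h : Cross s l p q) :
    s ≠ l ∧ s ≠ p ∧ s ≠ q ∧ l ≠ p ∧ l ≠ q ∧ p ≠ q := by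
  unfold Cross Cyc4 at h
  simp only [Fin.lt_def, ne_eq, Fin.ext_iff] at *
  omega

theorem not_cross_of_rpos {n : ℕ} {y s l p q : Fin n} (h1 : rpos y s < rpos y p)
    (h2 : rpos y s < rpos y q) (h3 : rpos y l < rpos y p) (h4 : rpos y l < rpos y q) :
    ¬ Cross s l p q := by
  intro hc
  unfold Cross Cyc4 at hc
  unfold rpos at h1 h2 h3 h4
  have := s.isLt
  have := l.isLt
  have := p.isLt
  have := q.isLt
  simp only [Fin.lt_def] at *
  split_ifs at h1 h2 h3 h4 <;> omega

theorem NC4_of_NC {n : ℕ} {M : Matroid (Fin n)} (hE : M.E = Set.univ) (h : NC M) :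
    NC4 M.IsBase := by
  intro U s l p q hs hl hp hq hc h1 h2 h3 h4
  obtain ⟨n1, n2, n3, n4, n5, n6⟩ := hc.ne
  rw [Set.insert_comm] at h1 h2
  have hpT : p ∉ insert l U := by
    rintro (h | h)
    · exact n4 h.symm
    · exact hp h
  have hqT : q ∉ insert l U := by
    rintro (h | h)
    · exact n5 h.symm
    · exact hq h
  refine base_swap hE h1 hpT ?_
  intro hcl
  refine h (insert l U) l s p q h1 hpT (base_notMem_closure h2 hqT) (Or.inl rfl) hcl ?_ hc
  have e : insert l U \ {l} = U := by simp [hl]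
  rw [e]
  intro hcU
  refine base_notMem_closure h3 ?_ (cl_mono (Set.subset_insert _ _) hcU)
  rintro (h | h)
  · exact n2 h
  · exact hs h

theorem NC_of_NC4 {n : ℕ} {M : Matroid (Fin n)} (hE : M.E = Set.univ) (h : NC4 M.IsBase) :
    NC M := by
  intro T l s p q hb hp hq hl hs hs' hc
  obtain ⟨n1, n2, n3, n4, n5, n6⟩ := hc.ne
  set U := T \ {l} with hU
  have hT : insert l U = T := by
    rw [hU, Set.insert_sdiff_singleton, Set.insert_eq_of_mem hl]
  have hbq : M.IsBase (insert q T) := base_swap hE hb hp hq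
  have hsU : s ∉ U := fun h => hs' (cl_mem hE h)
  have hlU : l ∉ U := by simp [hU]
  have hqT : q ∉ T := fun h => hq (cl_mem hE h)
  have key : ∀ p, p ∉ T → M.IsBase (insert p T) → p ≠ s → p ≠ l → M.IsBase (insert l (insert p U)) ∧
      M.IsBase (insert s (insert p U)) := by
    intro p hp hb hps hpl
    have h1 : M.IsBase (insert l (insert p U)) := by
      rw [Set.insert_comm, hT]; exact hb
    refine ⟨h1, base_swap hE h1 ?_ ?_⟩
    · rintro (h | h)
      · exact hpl h.symm
      · exact hlU h
    · intro h2
      have h3 : M.Indep (insert p U ∪ T) := hb.indep.subset (by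
        rintro z ((rfl | hz) | hz)
        · exact Or.inl rfl
        · exact Or.inr hz.1
        · exact Or.inr hz)
      have h4 : s ∈ M.closure (insert p U ∩ T) := by
        rw [h3.closure_inter_eq_inter_closure]
        exact ⟨h2, hs⟩
      refine hs' (cl_mono ?_ h4)
      rintro z ⟨rfl | hz, h5⟩
      · exact absurd h5 hp
      · exact hz
  obtain ⟨k1, k2⟩ := key p hp hb n2.symm n4.symm
  obtain ⟨k3, k4⟩ := key q hqT hbq n3.symm n5.symm
  have h5 := h U s l p q hsU hlU (fun h => hp h.1) (fun h => hqT h.1) hc k1 k3 k2 k4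
  refine base_notMem_closure h5 ?_ (by rw [hT]; exact hs)
  rintro (h | h)
  · exact n1 h
  · exact hsU h

theorem span_of_card {n : ℕ} {M : Matroid (Fin n)} {I Z A : Set (Fin n)} (hI : M.Indep I)
    (hZ : M.Indep Z) (hA : A ⊆ M.closure (I ∩ A)) (hc : (I ∩ A).ncard ≤ (Z ∩ A).ncard)
    (hE : M.E = Set.univ) :
    A ⊆ M.closure (Z ∩ A) := by
  have h1 : M.IsBasis (I ∩ A) A :=
    (hI.subset Set.inter_subset_left).isBasis_of_subset_of_subset_closure Set.inter_subset_right hA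
  obtain ⟨J, hJ, hJs⟩ := (hZ.subset Set.inter_subset_left).subset_isBasis_of_subset
    (Set.inter_subset_right (s := Z) (t := A)) (by simp [hE])
  have h2 := hJ.encard_eq_encard h1
  have h3 : J.ncard = (I ∩ A).ncard := by rw [Set.ncard, Set.ncard, h2]
  have h4 : Z ∩ A = J := Set.eq_of_subset_of_ncard_le hJs (by omega) (Set.toFinite _)
  rw [h4]
  exact hJ.subset_closure

namespace BD

variable {n : ℕ} {M : Matroid (Fin n)} {x y j : Fin n}

theorem nc4 (D : BD M x y j) : NC4 (Good M x y j) := by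
  intro U s l p q hs hl hp hq hc h1 h2 h3 h4
  have hE := D.hE
  have hI := NC4_of_NC hE D.nc U s l p q hs hl hp hq hc h1.1 h2.1 h3.1 h4.1
  refine ⟨hI, ?_⟩
  obtain ⟨n1, n2, n3, n4, n5, n6⟩ := hc.ne
  set I := insert s (insert l U) with hIdef
  rintro ⟨hy, hx, hS⟩
  set T := I \ {y} with hT
  have hIT : insert y T = I := by
    rw [hT, Set.insert_sdiff_singleton, Set.insert_eq_of_mem hy]
  have hyT : y ∉ M.closure T := hI.indep.notMem_closure_sdiff_of_mem hy
  have hyT' : y ∉ T := by simp [hT]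
  have hxT : x ∉ M.closure T := fun h => hyT (D.yofx hS h)
  classical
  obtain ⟨w, hw, hwmin⟩ := Finset.exists_min_image
    (Finset.univ.filter fun z => z ∉ M.closure T ∧ z ≠ y) (rpos y)
    ⟨x, by simp [hxT, ne_of_lt D.xy]⟩
  simp only [Finset.mem_filter, Finset.mem_univ, true_and] at hw hwmin
  have hwx := hwmin x ⟨hxT, ne_of_lt D.xy⟩
  set A : Set (Fin n) := {z | rpos y z < rpos y w} with hA
  have hAT : ∀ z ∈ A, z ≠ y → z ∈ M.closure T := by
    intro z hz hzy
    by_contra h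
    have := hwmin z ⟨h, hzy⟩
    have hz' : rpos y z < rpos y w := hz
    omega
  have hxA : x ∉ A := fun h => by
    have h' : rpos y x < rpos y w := h
    omega
  have hw0 : 0 < rpos y w := by
    rcases Nat.eq_zero_or_pos (rpos y w) with h | h
    · exact absurd (rpos_inj (h.trans (rpos_self y).symm)) hw.2
    · exact h
  have hyA : y ∈ A := by
    change rpos y y < rpos y w
    rw [rpos_self]; exact hw0
  have hwI : w ∉ I := by
    rw [← hIT]
    rintro (h | h)
    · exact hw.2 h
    · exact hw.1 (cl_mem hE h)
  have hwf : Free M w := free_mk hw.1 (cl_base hE hI w) hwI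
  have hwS : w ∉ SS M y j := fun h => hw.1 (hS h)
  have hSA : SS M y j ⊆ A := by
    intro k hk
    change rpos y k < rpos y w
    have h1 : ¬ (y < w ∧ w ≤ j) := fun h => hwS ⟨hwf, h⟩
    have h2 := hk.2
    have h3 := w.isLt
    have h4 := k.isLt
    have h5 : w.val ≠ y.val := fun h => hw.2 (Fin.ext h)
    unfold rpos
    simp only [Fin.lt_def, Fin.le_def] at *
    split_ifs <;> omega
  have hTi : M.Indep T := hI.indep.subset Set.sdiff_subset
  have hTA : ∀ z ∈ A, z ≠ y → z ∈ M.closure (T ∩ A) := by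
    intro z hz hzy
    have hzT := hAT z hz hzy
    by_contra hcon
    obtain ⟨l', hl', hlA, hlc⟩ := exists_fund_of_notMem hTi hzT hcon
    have hlA' : ¬ (rpos y l' < rpos y w) := hlA
    have hne : rpos y w ≠ rpos y l' := by
      intro h
      rw [← rpos_inj h] at hl'
      exact hw.1 (cl_mem hE hl')
    refine D.nc T l' z y w (by rw [hIT]; exact hI) hyT' hw.1 hl' hzT hlc ?_
    refine Or.inr (cyc4_of_rpos (q := y) (a := y) (b := z) (c := w) (d := l') ?_ hz (by omega)).rot
    rw [rpos_self]
    rcases Nat.eq_zero_or_pos (rpos y z) with h | h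
    · exact absurd (rpos_inj (h.trans (rpos_self y).symm)) hzy
    · exact h
  have hIA : A ⊆ M.closure (I ∩ A) := by
    intro z hz
    by_cases hzy : z = y
    · rw [hzy]; exact cl_mem hE ⟨hy, hyA⟩
    · exact cl_mono (fun w hw => ⟨hw.1.1, hw.2⟩) (hTA z hz hzy)
  -- a good base with a large intersection with `A`
  have main : ∀ Z, Good M x y j Z → (I ∩ A).ncard ≤ (Z ∩ A).ncard → False := by
    intro Z hZ hcard
    have hsp := span_of_card hI.indep hZ.1.indep hIA hcard hE
    have hyZ : y ∈ Z := by
      by_contra hyZ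
      refine hyT (cl_sub ?_ (hsp hyA))
      rintro z ⟨k1, k2⟩
      refine hAT z k2 ?_
      rintro rfl
      exact hyZ k1
    apply hZ.2
    refine ⟨hyZ, ?_, ?_⟩
    · intro hxZ
      have hxc : x ∈ M.closure (Z ∩ A) := D.xofy (fun k hk => hsp (hSA hk)) (hsp hyA)
      refine hZ.1.indep.notMem_closure_sdiff_of_mem hxZ (cl_mono ?_ hxc)
      rintro z ⟨k1, k2⟩
      refine ⟨k1, ?_⟩
      rintro rfl
      exact hxA k2
    · intro k hk
      have := D.span_of (B := Z ∩ A) (X := T) (hsp (hSA hk)) ⟨hyZ, hyA⟩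
        (fun z hz => hAT z hz.1.2 hz.2) hyT (hS hk)
      exact cl_mono (fun z hz => ⟨hz.1.1, hz.2⟩) this
  have fin : ∀ X : Set (Fin n), X.Finite := fun X => Set.toFinite X
  have sub : ∀ Z, Good M x y j Z → I ∩ A ⊆ Z → False := by
    intro Z hZ h
    exact main Z hZ (Set.ncard_le_ncard (fun z hz => ⟨h hz, hz.2⟩) (fin _))
  by_cases hsA : s ∈ A
  · by_cases hlA : l ∈ A
    · have hcard : ∀ p, s ≠ p → p ∉ U → p ∈ A → (I ∩ A).ncard ≤ ((insert s (insert p U)) ∩ A).ncard := by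
        intro p hps hp hpA
        have e1 : I ∩ A = insert s (insert l (U ∩ A)) := by
          rw [hIdef, Set.insert_inter_of_mem hsA, Set.insert_inter_of_mem hlA]
        have e2 : (insert s (insert p U)) ∩ A = insert s (insert p (U ∩ A)) := by
          rw [Set.insert_inter_of_mem hsA, Set.insert_inter_of_mem hpA]
        rw [e1, e2, Set.ncard_insert_of_notMem (by simp [hs, n1]) (fin _),
          Set.ncard_insert_of_notMem (by simp [hl]) (fin _),
          Set.ncard_insert_of_notMem (by simp [hs, hps]) (fin _),
          Set.ncard_insert_of_notMem (by simp [hp]) (fin _)]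
      have hpq : p ∈ A ∨ q ∈ A := by
        by_contra hcon
        push Not at hcon
        have c1 : rpos y s < rpos y w := hsA
        have c2 : rpos y l < rpos y w := hlA
        have c3 : ¬ rpos y p < rpos y w := hcon.1
        have c4 : ¬ rpos y q < rpos y w := hcon.2
        have c5 : rpos y s < rpos y p := by omega
        have c6 : rpos y s < rpos y q := by omega
        have c7 : rpos y l < rpos y p := by omega
        have c8 : rpos y l < rpos y q := by omega
        exact not_cross_of_rpos c5 c6 c7 c8 hc
      rcases hpq with h | h
      · exact main _ h3 (hcard p n2 hp h)
      · exact main _ h4 (hcard q n3 hq h)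
    · refine sub _ h3 ?_
      rintro z ⟨rfl | rfl | h, hzA⟩
      · exact Or.inl rfl
      · exact absurd hzA hlA
      · exact Or.inr (Or.inr h)
  · refine sub _ h1 ?_
    rintro z ⟨rfl | rfl | h, hzA⟩
    · exact absurd hzA hsA
    · exact Or.inl rfl
    · exact Or.inr (Or.inr h)

end BD


theorem mk_matroid {n : ℕ} (P : Set (Fin n) → Prop) (hne : ∃ B, P B)
    (hex : ∀ B1 B2, P B1 → P B2 → ∀ b ∈ B1, b ∉ B2 → ∃ c ∈ B2, c ∉ B1 ∧ P (insert c (B1 \ {b}))) :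
    ∃ M : Matroid (Fin n), M.E = Set.univ ∧ ∀ B, M.IsBase B ↔ P B := by
  refine ⟨Matroid.ofIsBaseOfFinite (Set.toFinite Set.univ) P hne ?_ (fun B _ => Set.subset_univ _),
    rfl, fun B => Iff.rfl⟩
  intro B1 B2 h1 h2 b hb
  obtain ⟨c, k1, k2, k3⟩ := hex B1 B2 h1 h2 b hb.1 hb.2
  exact ⟨c, ⟨k1, k2⟩, k3⟩

theorem indep_of_upper {n : ℕ} {M : Matroid (Fin n)} (hE : M.E = Set.univ) (J : Finset (Fin n)) :
    (∀ w ∈ J, w ∉ M.closure {z | z ∈ J ∧ w < z}) → M.Indep ↑J := by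
  induction J using Finset.induction_on_min with
  | empty => intro _; simp
  | insert a s ha ih =>
    intro h
    have h1 : M.Indep ↑s := ih fun w hw hc => h w (Finset.mem_insert_of_mem hw)
      (cl_mono (fun z hz => ⟨Finset.mem_insert_of_mem hz.1, hz.2⟩) hc)
    have h2 : a ∉ M.closure ↑s := fun hc => h a (Finset.mem_insert_self _ _)
      (cl_mono (fun z hz => ⟨Finset.mem_insert_of_mem hz, ha z hz⟩) hc)
    rw [Finset.coe_insert]
    exact ((h1.notMem_closure_iff (by simp [hE])).1 h2).1

theorem exists_BD {n : ℕ} {M : Matroid (Fin n)} (hE : M.E = Set.univ) (hNC : NC M) {z0 : Fin n}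
    (hz0 : Free M z0) : ∃ x y j, BD M x y j := by
  classical
  have hX : ∃ x, Free M x ∧ x ∈ M.closure {z | Free M z ∧ x < z} := by
    by_contra hcon
    push Not at hcon
    have hind := indep_of_upper hE (Finset.univ.filter fun z => Free M z) (by
      intro w hw hc
      simp only [Finset.mem_filter, Finset.mem_univ, true_and] at hw hc
      exact hcon w hw hc)
    obtain ⟨J, hJ⟩ := M.exists_isBasis {z0}ᶜ (by simp [hE])
    have h1 : z0 ∈ M.closure J := by rw [hJ.closure_eq_closure]; exact hz0.2
    have h2 : z0 ∉ J := fun h => hJ.subset h rfl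
    have h3 : z0 ∈ M.closure (J ∩ {z | Free M z}) := by
      refine fund_mem_closure hJ.indep h1 fun i hi hic => ?_
      refine free_of_fund hJ.indep hi h1 hic ?_
      rintro rfl
      exact h2 hi
    refine hind.notMem_closure_sdiff_of_mem (e := z0) (by simpa using hz0) (cl_mono ?_ h3)
    rintro z ⟨h4, h5⟩
    refine ⟨by simpa using h5, ?_⟩
    rintro rfl
    exact h2 h4
  obtain ⟨x, hx, hxmax⟩ := Finset.exists_max_image
    (Finset.univ.filter fun x => Free M x ∧ x ∈ M.closure {z | Free M z ∧ x < z}) id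
    (by obtain ⟨x, hx⟩ := hX; exact ⟨x, by simpa using hx⟩)
  simp only [Finset.mem_filter, Finset.mem_univ, true_and, id] at hx hxmax
  have hYne : (Finset.univ.filter fun z => Free M z ∧ x < z).Nonempty := by
    by_contra hcon
    rw [Finset.not_nonempty_iff_eq_empty, Finset.filter_eq_empty_iff] at hcon
    exact hx.1.1 (cl_mono (fun z hz => (hcon (Finset.mem_univ z) hz).elim) hx.2)
  obtain ⟨y, hy, hymin⟩ := Finset.exists_min_image _ id hYne
  obtain ⟨m, hm, hmmax⟩ := Finset.exists_max_image _ id hYne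
  simp only [Finset.mem_filter, Finset.mem_univ, true_and, id] at hy hymin hm hmmax
  obtain ⟨j, hj, hjmin⟩ := Finset.exists_min_image
    (Finset.univ.filter fun j => (Free M j ∧ x < j) ∧
      x ∈ M.closure {z | Free M z ∧ x < z ∧ z ≤ j}) id
    ⟨m, by
      simp only [Finset.mem_filter, Finset.mem_univ, true_and]
      exact ⟨hm, cl_mono (fun z hz => ⟨hz.1, hz.2, hmmax z hz⟩) hx.2⟩⟩
  simp only [Finset.mem_filter, Finset.mem_univ, true_and, id] at hj hjmin
  refine ⟨x, y, j, hE, hNC, hx.1, hy.1, hj.1.1, hy.2, hymin j hj.1, fun z h1 h2 =>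
    hymin z ⟨h1, h2⟩, ?_, hj.2, ?_⟩
  · have := indep_of_upper hE (Finset.univ.filter fun z => Free M z ∧ x < z) (by
      intro w hw hc
      simp only [Finset.mem_filter, Finset.mem_univ, true_and] at hw hc
      have := hxmax w ⟨hw.1, cl_mono (fun z hz => ⟨hz.1.1, hz.2⟩) hc⟩
      exact absurd (lt_of_lt_of_le hw.2 this) (lt_irrefl _))
    simpa using this
  · intro hc
    have hne : (Finset.univ.filter fun z => Free M z ∧ x < z ∧ z < j).Nonempty := by
      by_contra hcon
      rw [Finset.not_nonempty_iff_eq_empty, Finset.filter_eq_empty_iff] at hcon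
      exact hx.1.1 (cl_mono (fun z hz => (hcon (Finset.mem_univ z) hz).elim) hc)
    obtain ⟨j2, hj2, hj2max⟩ := Finset.exists_max_image _ id hne
    simp only [Finset.mem_filter, Finset.mem_univ, true_and, id] at hj2 hj2max
    have := hjmin j2 ⟨⟨hj2.1, hj2.2.1⟩, cl_mono (fun z hz => ⟨hz.1, hz.2.1, hj2max z hz⟩) hc⟩
    exact absurd (lt_of_lt_of_le hj2.2.2 this) (lt_irrefl _)

theorem free_of_bases {n : ℕ} {M : Matroid (Fin n)} (hE : M.E = Set.univ) {B1 B2 : Set (Fin n)}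
    (h1 : M.IsBase B1) (h2 : M.IsBase B2) {z : Fin n} (hz1 : z ∈ B1) (hz2 : z ∉ B2) : Free M z :=
  free_mk (h1.indep.notMem_closure_sdiff_of_mem hz1) (cl_base hE h2 z) hz2

/-- Undoing a bridge: either there is a unique base, or there is a smaller noncrossing matroid. -/
theorem bridge_step {n : ℕ} {M : Matroid (Fin n)} (hE : M.E = Set.univ) (hNC : NC M) :
    (∀ B1 B2, M.IsBase B1 → M.IsBase B2 → B1 = B2) ∨
    ∃ (M' : Matroid (Fin n)) (x y : Fin n), M'.E = Set.univ ∧ NC M' ∧ x < y ∧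
      {B | M'.IsBase B} ⊂ {B | M.IsBase B} ∧
      (∀ B1 B2, M.IsBase B1 → M.IsBase B2 → ∀ z, x < z → z < y → (z ∈ B1 ↔ z ∈ B2)) ∧
      (∀ I, M.IsBase I ↔ M'.IsBase I ∨ (y ∈ I ∧ x ∉ I ∧ M'.IsBase (insert x (I \ {y})))) := by
  by_cases hf : ∃ z0, Free M z0
  · right
    obtain ⟨z0, hz0⟩ := hf
    obtain ⟨x, y, j, D⟩ := exists_BD hE hNC hz0
    obtain ⟨M', hE', hM'⟩ := mk_matroid (Good M x y j) D.good_exists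
      (fun B1 B2 h1 h2 b hb hb' => D.exch h1 h2 hb hb')
    have hfun : M'.IsBase = Good M x y j := by
      ext B; exact hM' B
    refine ⟨M', x, y, hE', NC_of_NC4 hE' (by rw [hfun]; exact D.nc4), D.xy, ⟨fun B hB => ?_, ?_⟩,
      ?_, ?_⟩
    · exact ((hM' B).1 hB).1
    · intro h
      obtain ⟨B, hB, hb⟩ := D.bad_exists
      exact ((hM' B).1 (h hB)).2 hb
    · have : ∀ B1 B2, M.IsBase B1 → M.IsBase B2 → ∀ z, x < z → z < y → (z ∈ B1 → z ∈ B2) := by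
        intro B1 B2 h1 h2 z hxz hzy hz
        by_contra hz2
        exact absurd (lt_of_le_of_lt (D.next z (free_of_bases hE h1 h2 hz hz2) hxz) hzy)
          (lt_irrefl _)
      exact fun B1 B2 h1 h2 z hxz hzy => ⟨this B1 B2 h1 h2 z hxz hzy, this B2 B1 h2 h1 z hxz hzy⟩
    · intro I
      rw [hfun]
      exact D.bridge I
  · left
    push Not at hf
    have : ∀ B1 B2, M.IsBase B1 → M.IsBase B2 → B1 ⊆ B2 := by
      intro B1 B2 h1 h2 z hz
      by_contra hz2
      exact hf z (free_of_bases hE h1 h2 hz hz2)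
    exact fun B1 B2 h1 h2 => Set.Subset.antisymm (this B1 B2 h1 h2) (this B2 B1 h2 h1)


/-! ## Minors -/

/-- The determinant of the matrix of columns listed by `f`. -/
noncomputable def DD {n d : ℕ} (A : Matrix (Fin d) (Fin n) ℝ) (f : Fin d → Fin n) : ℝ :=
  (A.submatrix id f).det

/-- Maximal minor indexed by a set. -/
noncomputable def minor {n d : ℕ} (A : Matrix (Fin d) (Fin n) ℝ) (I : Finset (Fin n))
    (h : I.card = d) : ℝ := DD A (I.orderEmbOfFin h)

/-- A sign attached to an ordered pair. -/
noncomputable def sgp {n : ℕ} (u v : Fin n) : ℝ := if u < v then 1 else -1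

/-- The sign of a listing. -/
noncomputable def sg {n d : ℕ} (f : Fin d → Fin n) : ℝ := ∏ i, ∏ j ∈ Finset.Ioi i, sgp (f i) (f j)

theorem sgp_sq {n : ℕ} (u v : Fin n) : sgp u v * sgp u v = 1 := by
  unfold sgp; split_ifs <;> norm_num

theorem sg_sq {n d : ℕ} (f : Fin d → Fin n) : sg f * sg f = 1 := by
  unfold sg
  rw [← Finset.prod_mul_distrib]
  refine Finset.prod_eq_one fun i _ => ?_
  rw [← Finset.prod_mul_distrib]
  exact Finset.prod_eq_one fun j _ => sgp_sq _ _

theorem DD_eq {n d : ℕ} (A : Matrix (Fin d) (Fin n) ℝ) (f : Fin d → Fin n)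
    (hf : Function.Injective f) (I : Finset (Fin n)) (h : I.card = d)
    (hI : ∀ z, z ∈ I ↔ ∃ i, f i = z) : DD A f = sg f * minor A I h := by
  have hmem : ∀ i, f i ∈ I := fun i => (hI _).2 ⟨i, rfl⟩
  let e := I.orderIsoOfFin h
  let σ0 : Fin d → Fin d := fun i => e.symm ⟨f i, hmem i⟩
  have hinj : Function.Injective σ0 := by
    intro a b hab
    have := e.symm.injective hab
    exact hf (by simpa using this)
  let σ : Equiv.Perm (Fin d) := Equiv.ofBijective σ0 (Finite.injective_iff_bijective.1 hinj)
  have hfe : ∀ i, f i = I.orderEmbOfFin h (σ i) := by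
    intro i
    change f i = ((e (e.symm ⟨f i, hmem i⟩) : I) : Fin n)
    simp
  have h1 : DD A f = (Equiv.Perm.sign σ : ℤ) * minor A I h := by
    unfold minor DD
    rw [← Matrix.det_permute', Matrix.submatrix_submatrix]
    congr 2
    ext i
    simp [hfe i]
  rw [h1]
  congr 1
  rw [Equiv.Perm.sign_eq_prod_prod_Ioi]
  push_cast
  unfold sg
  refine Finset.prod_congr rfl fun i _ => Finset.prod_congr rfl fun j _ => ?_
  unfold sgp
  rw [hfe i, hfe j]
  simp only [(I.orderEmbOfFin h).lt_iff_lt]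
  split_ifs <;> simp

theorem minor_eq {n d : ℕ} (A : Matrix (Fin d) (Fin n) ℝ) (f : Fin d → Fin n)
    (hf : Function.Injective f) (I : Finset (Fin n)) (h : I.card = d)
    (hI : ∀ z, z ∈ I ↔ ∃ i, f i = z) : minor A I h = sg f * DD A f := by
  rw [DD_eq A f hf I h hI, ← mul_assoc, sg_sq, one_mul]

theorem sg_cons {n d : ℕ} (u : Fin n) (g : Fin d → Fin n) :
    sg (Fin.cons u g : Fin (d + 1) → Fin n) = (∏ i, sgp u (g i)) * sg g := by
  unfold sg
  rw [Fin.prod_univ_succ, Fin.prod_Ioi_zero]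
  simp [Fin.prod_Ioi_succ]

/-- Linearity of `DD` in the first column. -/
theorem DD_cons_congr {n d : ℕ} (A A' : Matrix (Fin (d + 1)) (Fin n) ℝ) (x y : Fin n) (t : ℝ)
    (g : Fin d → Fin n) (hy : ∀ i, A' i y = A i y + t * A i x)
    (hg : ∀ k i, A' i (g k) = A i (g k)) :
    DD A' (Fin.cons y g) = DD A (Fin.cons y g) + t * DD A (Fin.cons x g) := by
  unfold DD
  have e : ∀ z, A.submatrix id (Fin.cons z g : Fin (d + 1) → Fin n) =
      (A.submatrix id (Fin.cons y g : Fin (d + 1) → Fin n)).updateCol 0 (fun i => A i z) := by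
    intro z
    ext i k
    refine Fin.cases ?_ (fun k => ?_) k
    · simp
    · simp [Matrix.updateCol_apply]
  have e' : A'.submatrix id (Fin.cons y g : Fin (d + 1) → Fin n) =
      (A.submatrix id (Fin.cons y g : Fin (d + 1) → Fin n)).updateCol 0
        ((fun i => A i y) + t • (fun i => A i x)) := by
    ext i k
    refine Fin.cases ?_ (fun k => ?_) k
    · simp [hy]
    · simp [Matrix.updateCol_apply, hg]
  rw [e', Matrix.det_updateCol_add, Matrix.det_updateCol_smul, ← e, ← e]

theorem DD_congr {n d : ℕ} (A A' : Matrix (Fin d) (Fin n) ℝ) (f : Fin d → Fin n)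
    (h : ∀ k i, A' i (f k) = A i (f k)) : DD A' f = DD A f := by
  unfold DD
  congr 1
  ext i k
  simp [h]

/-- Three-term Plücker relation for row vectors. -/
theorem pluecker_rows {m : ℕ} (a b c d : Fin (m + 2) → ℝ) (G : Fin m → Fin (m + 2) → ℝ) :
    let D := fun u v : Fin (m + 2) → ℝ =>
      (Matrix.of (Fin.cons u (Fin.cons v G : Fin (m + 1) → Fin (m + 2) → ℝ) :
        Fin (m + 2) → Fin (m + 2) → ℝ)).det
    D a b * D c d = D c b * D a d + D a c * D b d := by
  intro D
  let R : Matrix (Fin (m + 2)) (Fin (m + 2)) ℝ :=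
    Matrix.of (Fin.cons a (Fin.cons b G : Fin (m + 1) → Fin (m + 2) → ℝ))
  have h1 := Matrix.mulVec_cramer R.transpose c
  rw [Matrix.det_transpose] at h1
  have h2 : R.det • c = D c b • a + (D a c • b + ∑ k, R.transpose.cramer c k.succ.succ • G k) := by
    rw [← h1]
    ext i
    simp only [Matrix.mulVec, dotProduct, Pi.add_apply, Pi.smul_apply, smul_eq_mul,
      Finset.sum_apply]
    rw [Fin.sum_univ_succ, Fin.sum_univ_succ]
    have r0 : R.transpose.cramer c 0 = D c b := by
      rw [Matrix.cramer_transpose_apply]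
      congr 1
      ext i k
      refine Fin.cases ?_ (fun i => ?_) i
      · simp [R]
      · simp [R, Matrix.updateRow_apply]
    have r1 : R.transpose.cramer c (Fin.succ 0) = D a c := by
      rw [Matrix.cramer_transpose_apply]
      congr 1
      ext i k
      refine Fin.cases ?_ (fun i => Fin.cases ?_ (fun i => ?_) i) i
      · simp [R, Matrix.updateRow_apply]
      · simp [R, Matrix.updateRow_apply]
      · simp [R, Matrix.updateRow_apply, Fin.ext_iff]
    rw [r0, r1]
    simp [R, mul_comm]
  let L : (Fin (m + 2) → ℝ) →ₗ[ℝ] ℝ :=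
    { toFun := fun u => D u d
      map_add' := fun u v => by
        have := (Matrix.detRowAlternating (R := ℝ) (n := Fin (m + 2))).toMultilinearMap.cons_add
          (Fin.cons d G) u v
        exact this
      map_smul' := fun t u => by
        have := (Matrix.detRowAlternating (R := ℝ) (n := Fin (m + 2))).toMultilinearMap.cons_smul
          (Fin.cons d G) t u
        exact this }
  have h3 := congrArg L h2
  simp only [map_add, map_smul, map_sum, smul_eq_mul] at h3
  have h4 : ∀ k, L (G k) = 0 := by
    intro k
    change (Matrix.of _).det = 0
    refine Matrix.det_zero_of_row_eq (i := 0) (j := k.succ.succ) (by simp [Fin.ext_iff]) ?_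
    ext i
    simp
  simp only [h4, mul_zero, Finset.sum_const_zero, add_zero] at h3
  exact h3

theorem DD_pluecker {n m : ℕ} (A : Matrix (Fin (m + 2)) (Fin n) ℝ) (g : Fin m → Fin n)
    (a b c d : Fin n) :
    let D := fun u v : Fin n => DD A (Fin.cons u (Fin.cons v g : Fin (m + 1) → Fin n))
    D a c * D b d = D a b * D c d + D a d * D b c := by
  intro D
  have h := pluecker_rows (fun i => A i a) (fun i => A i b) (fun i => A i c) (fun i => A i d)
    (fun k i => A i (g k))
  have e : ∀ u v : Fin n, (Matrix.of (Fin.cons (fun i => A i u)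
      (Fin.cons (fun i => A i v) (fun k i => A i (g k)) : Fin (m + 1) → Fin (m + 2) → ℝ) :
        Fin (m + 2) → Fin (m + 2) → ℝ)).det = D u v := by
    intro u v
    change _ = (Matrix.submatrix _ _ _).det
    rw [← Matrix.det_transpose]
    congr 1
    ext i k
    refine Fin.cases ?_ (fun k => Fin.cases ?_ (fun k => ?_) k) k <;> simp
  simp only [e] at h
  have hs : D c b = - D b c := by
    change (A.submatrix _ _).det = - (A.submatrix _ _).det
    have := Matrix.det_permute' (Equiv.swap (0 : Fin (m + 2)) (Fin.succ 0))
      (A.submatrix id (Fin.cons b (Fin.cons c g : Fin (m + 1) → Fin n) : Fin (m + 2) → Fin n))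
    rw [Equiv.Perm.sign_swap (by simp [Fin.ext_iff])] at this
    simp only [Units.val_neg, Units.val_one, Int.cast_neg, Int.cast_one, neg_mul, one_mul] at this
    rw [← this]
    congr 1
    ext i k
    refine Fin.cases ?_ (fun k => Fin.cases ?_ (fun k => ?_) k) k
    · simp
    · simp [Equiv.swap_apply_right]
    · rw [Matrix.submatrix_apply, Matrix.submatrix_apply, Matrix.submatrix_apply,
        Equiv.swap_apply_of_ne_of_ne (by simp [Fin.ext_iff]) (by simp [Fin.ext_iff])]
      simp
  rw [hs] at h
  linarith


theorem strictMono_minor {n d : ℕ} (A : Matrix (Fin d) (Fin n) ℝ) (f : Fin d → Fin n)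
    (hf : StrictMono f) :
    ∃ (I : Finset (Fin n)) (h : I.card = d), DD A f = minor A I h := by
  have h : (Finset.univ.image f).card = d := by
    rw [Finset.card_image_of_injective _ hf.injective]; simp
  refine ⟨Finset.univ.image f, h, ?_⟩
  unfold minor
  rw [← Finset.orderEmbOfFin_unique h (f := f) (fun i => by simp) hf]

theorem linInd_iff {n d : ℕ} (A : Matrix (Fin d) (Fin n) ℝ) (I : Finset (Fin n)) (h : I.card = d) :
    LinearIndependent ℝ (fun j : I => fun i => A i j.1) ↔ minor A I h ≠ 0 := by
  rw [← linearIndependent_equiv (I.orderIsoOfFin h).toEquiv]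
  have := Matrix.linearIndependent_cols_iff_isUnit (A := A.submatrix id (I.orderEmbOfFin h))
  rw [Matrix.isUnit_iff_isUnit_det, isUnit_iff_ne_zero] at this
  exact this

theorem rank_eq {n d : ℕ} (A : Matrix (Fin d) (Fin n) ℝ) (I : Finset (Fin n)) (h : I.card = d)
    (hI : minor A I h ≠ 0) : A.rank = d := by
  apply le_antisymm
  · simpa using A.rank_le_height
  · have h1 : (A.submatrix id (I.orderEmbOfFin h)).rank = d := by
      have := Matrix.rank_of_isUnit (A.submatrix id (I.orderEmbOfFin h))
        ((Matrix.isUnit_iff_isUnit_det _).2 (isUnit_iff_ne_zero.2 hI))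
      simpa using this
    have h2 : A.submatrix id (I.orderEmbOfFin h) =
        A * (1 : Matrix (Fin n) (Fin n) ℝ).submatrix id (I.orderEmbOfFin h) := by
      ext i k
      simp [Matrix.mul_apply, Matrix.one_apply]
    calc d = (A.submatrix id (I.orderEmbOfFin h)).rank := h1.symm
      _ = (A * (1 : Matrix (Fin n) (Fin n) ℝ).submatrix id (I.orderEmbOfFin h)).rank :=
        congrArg Matrix.rank h2
      _ ≤ A.rank := Matrix.rank_mul_le_left _ _

/-- The minors of a matrix after adding a multiple of a column. -/
theorem minor_bridge {n d : ℕ} (A : Matrix (Fin d) (Fin n) ℝ) (x y : Fin n) (hxy : x < y) (t : ℝ)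
    (A' : Matrix (Fin d) (Fin n) ℝ)
    (hA' : A' = Matrix.of fun i k => if k = y then A i y + t * A i x else A i k)
    (I : Finset (Fin n)) (h : I.card = d) :
    (¬ (y ∈ I ∧ x ∉ I) → minor A' I h = minor A I h) ∧
    (∀ (hy : y ∈ I) (hx : x ∉ I) (h' : (insert x (I.erase y)).card = d), minor A' I h = minor A I h +
      t * (∏ z ∈ I.erase y, if x < z ∧ z < y then -1 else 1) *
        minor A (insert x (I.erase y)) h') := by
  have hne : ∀ k i, k ≠ y → A' i k = A i k := by
    intro k i hk; simp [hA', hk]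
  have hyy : ∀ i, A' i y = A i y + t * A i x := by intro i; simp [hA']
  by_cases hyI : y ∈ I
  swap
  · refine ⟨fun _ => ?_, fun hy => absurd hy hyI⟩
    unfold minor
    refine DD_congr _ _ _ fun k i => hne _ _ ?_
    intro hk
    apply hyI
    rw [← hk]
    exact Finset.orderEmbOfFin_mem I h k
  obtain ⟨m, rfl⟩ : ∃ m, d = m + 1 := by
    rw [← h]
    exact ⟨I.card - 1, by have := Finset.card_pos.2 ⟨y, hyI⟩; omega⟩
  have hU : (I.erase y).card = m := by rw [Finset.card_erase_of_mem hyI]; omega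
  set U := I.erase y with hUdef
  have hyU : y ∉ U := by simp [hUdef]
  obtain ⟨g, hg⟩ : ∃ g : Fin m → Fin n, g = ⇑(U.orderEmbOfFin hU) := ⟨_, rfl⟩
  have hgmem : ∀ z, z ∈ U ↔ ∃ i, g i = z := by
    intro z
    have := Finset.range_orderEmbOfFin U hU
    have h2 : z ∈ Set.range g ↔ z ∈ (U : Set (Fin n)) := by rw [hg, this]
    rw [Set.mem_range, Finset.mem_coe] at h2
    exact h2.symm
  have hgU : ∀ i, g i ∈ U := fun i => (hgmem _).2 ⟨i, rfl⟩
  have hginj : Function.Injective g := by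
    rw [hg]; exact (U.orderEmbOfFin hU).injective
  have hcons : ∀ u, u ∉ U → Function.Injective (Fin.cons u g : Fin (m + 1) → Fin n) := by
    intro u hu
    rw [Fin.cons_injective_iff]
    exact ⟨fun ⟨i, hi⟩ => hu (hi ▸ hgU i), hginj⟩
  have hmem : ∀ u z, z ∈ insert u U ↔ ∃ i, (Fin.cons u g : Fin (m + 1) → Fin n) i = z := by
    intro u z
    rw [Fin.exists_fin_succ]
    simp only [Fin.cons_zero, Fin.cons_succ, Finset.mem_insert, hgmem]
    tauto
  have hIU : insert y U = I := Finset.insert_erase hyI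
  have hminor : ∀ (B : Matrix (Fin (m + 1)) (Fin n) ℝ), minor B I h =
      sg (Fin.cons y g : Fin (m + 1) → Fin n) * DD B (Fin.cons y g) := fun B =>
    minor_eq B _ (hcons y hyU) I h (by rw [← hIU]; exact hmem y)
  have hDD := DD_cons_congr A A' x y t g hyy (fun k i => hne _ _ (by
    intro hk
    rw [← hk] at hyU
    exact hyU (hgU k)))
  constructor
  · intro hcon
    have hxI : x ∈ I := by
      by_contra hx
      exact hcon ⟨hyI, hx⟩
    have hxU : x ∈ U := Finset.mem_erase.2 ⟨ne_of_lt hxy, hxI⟩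
    obtain ⟨i, hi⟩ := (hgmem x).1 hxU
    have h0 : DD A (Fin.cons x g) = 0 := by
      unfold DD
      refine Matrix.det_zero_of_column_eq (i := 0) (j := i.succ) (by simp [Fin.ext_iff]) ?_
      intro k
      simp [hi]
    rw [hminor, hminor, hDD, h0]
    ring
  · intro _ hx h'
    have hxU : x ∉ U := fun h => hx (Finset.mem_of_mem_erase h)
    have hx2 := DD_eq A _ (hcons x hxU) _ h' (hmem x)
    rw [hminor A', hDD, hx2, mul_add, ← hminor A, sg_cons, sg_cons]
    congr 1
    have e1 : (∏ i, sgp y (g i)) * (∏ i, sgp x (g i)) =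
        ∏ z ∈ U, if x < z ∧ z < y then (-1 : ℝ) else 1 := by
      have : U = Finset.univ.image g := by
        ext z; rw [hgmem]; simp
      rw [this, Finset.prod_image (fun a _ b _ hab => hginj hab), ← Finset.prod_mul_distrib]
      refine Finset.prod_congr rfl fun i _ => ?_
      have n1 : g i ≠ y := fun h => hyU (h ▸ hgU i)
      unfold sgp
      rcases lt_trichotomy (g i) y with h1 | h1 | h1
      · by_cases h2 : x < g i
        · simp [h1, h2, not_lt_of_gt h1]
        · simp [h2, not_lt_of_gt h1]
      · exact absurd h1 n1
      · simp [h1, hxy.trans h1, not_lt_of_gt h1]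
    rw [← e1]
    have := sg_sq g
    linear_combination (t * (∏ i, sgp y (g i)) * (∏ i, sgp x (g i)) *
      minor A (insert x U) h') * this

theorem realize {n d : ℕ} : ∀ (N : ℕ) (M : Matroid (Fin n)), {B | M.IsBase B}.ncard = N →
    M.E = Set.univ → NC M → (∀ B : Finset (Fin n), M.IsBase ↑B → B.card = d) →
    ∃ A : Matrix (Fin d) (Fin n) ℝ, ∀ (I : Finset (Fin n)) (h : I.card = d),
      0 ≤ minor A I h ∧ (minor A I h ≠ 0 ↔ M.IsBase ↑I) := by
  intro N
  induction N using Nat.strong_induction_on with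
  | h N ih =>
  intro M hN hE hNC hd
  classical
  rcases bridge_step hE hNC with hu | ⟨M', x, y, hE', hNC', hxy, hss, hbt, hbr⟩
  · obtain ⟨B0, hB0⟩ := M.exists_isBase
    obtain ⟨B, rfl⟩ : ∃ B : Finset (Fin n), (B : Set (Fin n)) = B0 := ⟨B0.toFinset, by simp⟩
    have hB := hd B hB0
    refine ⟨Matrix.of fun i k => if k = B.orderEmbOfFin hB i then 1 else 0, fun I h => ?_⟩
    by_cases hIB : I = B
    · subst hIB
      have : minor (Matrix.of fun i k => if k = I.orderEmbOfFin hB i then (1 : ℝ) else 0) I h = 1 := by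
        unfold minor DD
        convert Matrix.det_one (R := ℝ) (n := Fin d)
        ext i k
        simp [Matrix.one_apply, eq_comm]
      rw [this]
      exact ⟨zero_le_one, iff_of_true one_ne_zero hB0⟩
    · have hnb : ¬ M.IsBase ↑I := fun hI => hIB (by exact_mod_cast hu _ _ hI hB0)
      have : minor (Matrix.of fun i k => if k = B.orderEmbOfFin hB i then (1 : ℝ) else 0) I h = 0 := by
        obtain ⟨b, hb, hbI⟩ : ∃ b ∈ B, b ∉ I := by
          by_contra hcon
          push Not at hcon
          exact hIB (Finset.eq_of_subset_of_card_le hcon (by omega)).symm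
        have hbr : b ∈ Set.range (B.orderEmbOfFin hB) := by
          rw [Finset.range_orderEmbOfFin]; exact hb
        obtain ⟨i, hi⟩ := hbr
        unfold minor DD
        refine Matrix.det_eq_zero_of_row_eq_zero i fun k => ?_
        simp only [Matrix.submatrix_apply, Matrix.of_apply, id]
        rw [if_neg]
        rw [hi]
        intro hk
        exact hbI (hk ▸ Finset.orderEmbOfFin_mem I h k)
      rw [this]
      exact ⟨le_refl _, iff_of_false (by simp) hnb⟩
  · have hlt : {B | M'.IsBase B}.ncard < N := by
      rw [← hN]
      exact Set.ncard_lt_ncard hss (Set.toFinite _)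
    obtain ⟨A, hA⟩ := ih _ hlt M' rfl hE' hNC' (fun B hB => hd B (hss.1 hB))
    obtain ⟨B0, hB0⟩ := M.exists_isBase
    obtain ⟨B, rfl⟩ : ∃ B : Finset (Fin n), (B : Set (Fin n)) = B0 := ⟨B0.toFinset, by simp⟩
    set t : ℝ := ∏ z, if z ∈ B ∧ x < z ∧ z < y then -1 else 1 with ht
    have htt : t * t = 1 := by
      rw [ht, ← Finset.prod_mul_distrib]
      refine Finset.prod_eq_one fun z _ => ?_
      split_ifs <;> norm_num
    refine ⟨Matrix.of fun i k => if k = y then A i y + t * A i x else A i k, fun I h => ?_⟩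
    obtain ⟨m1, m2⟩ := minor_bridge A x y hxy t _ rfl I h
    have hbrI := hbr ↑I
    by_cases hc : y ∈ I ∧ x ∉ I
    · have h' : (insert x (I.erase y)).card = d := by
        rw [Finset.card_insert_of_notMem (fun h => hc.2 (Finset.mem_of_mem_erase h)),
          Finset.card_erase_of_mem hc.1, ← h]
        have := Finset.card_pos.2 ⟨y, hc.1⟩
        omega
      rw [m2 hc.1 hc.2 h']
      have e : ((insert x (I.erase y) : Finset (Fin n)) : Set (Fin n)) = insert x (↑I \ {y}) := by
        simp
      obtain ⟨a1, a2⟩ := hA I h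
      obtain ⟨b1, b2⟩ := hA _ h'
      have key : t * (∏ z ∈ I.erase y, if x < z ∧ z < y then -1 else 1) *
          minor A (insert x (I.erase y)) h' = minor A (insert x (I.erase y)) h' := by
        by_cases hz : minor A (insert x (I.erase y)) h' = 0
        · rw [hz, mul_zero]
        · have hb := b2.1 hz
          have hbI : M.IsBase ↑I := hbrI.2 (Or.inr ⟨by simpa using hc.1, by simpa using hc.2, by
            rw [← e]; exact hb⟩)
          have : (∏ z ∈ I.erase y, if x < z ∧ z < y then (-1 : ℝ) else 1) = t := by
            rw [ht, ← Finset.prod_subset (Finset.subset_univ (I.erase y))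
              (f := fun z => if z ∈ B ∧ x < z ∧ z < y then (-1 : ℝ) else 1)]
            · refine Finset.prod_congr rfl fun z hz => ?_
              have hzI : z ∈ I := Finset.mem_of_mem_erase hz
              by_cases hzz : x < z ∧ z < y
              · have := (hbt _ _ hbI hB0 z hzz.1 hzz.2).1 (by simpa using hzI)
                rw [if_pos hzz, if_pos ⟨by simpa using this, hzz⟩]
              · rw [if_neg hzz, if_neg (fun h => hzz h.2)]
            · intro z _ hz
              rw [if_neg]
              rintro ⟨h1, h2, h3⟩
              have := (hbt _ _ hbI hB0 z h2 h3).2 (by simpa using h1)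
              exact hz (Finset.mem_erase.2 ⟨ne_of_lt h3, by simpa using this⟩)
          rw [this, htt, one_mul]
      rw [key]
      refine ⟨add_nonneg a1 b1, ?_⟩
      rw [hbrI, ← e, ← a2, ← b2]
      constructor
      · intro hne
        by_cases hz : minor A I h = 0
        · right
          refine ⟨by simpa using hc.1, by simpa using hc.2, fun h0 => hne ?_⟩
          rw [hz, h0, add_zero]
        · exact Or.inl hz
      · rintro (h1 | ⟨_, _, h1⟩)
        · have := lt_of_le_of_ne a1 (Ne.symm h1)
          exact ne_of_gt (by linarith)
        · have := lt_of_le_of_ne b1 (Ne.symm h1)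
          exact ne_of_gt (by linarith)
    · rw [m1 hc]
      refine ⟨(hA I h).1, ?_⟩
      rw [(hA I h).2, hbrI]
      constructor
      · exact Or.inl
      · rintro (h1 | ⟨h1, h2, _⟩)
        · exact h1
        · exact absurd ⟨by simpa using h1, by simpa using h2⟩ hc


/-! ## Totally nonnegative matrices give non-crossing matroids -/

/-- Maximal minor indexed by a set, with value zero for sets of the wrong size. -/
noncomputable def mm {n d : ℕ} (A : Matrix (Fin d) (Fin n) ℝ) (I : Finset (Fin n)) : ℝ :=
  if h : I.card = d then minor A I h else 0

theorem mm_pluecker {n m : ℕ} (A : Matrix (Fin (m + 2)) (Fin n) ℝ) (U : Finset (Fin n))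
    (hU : U.card = m) (a b c e : Fin n) (ha : a ∉ U) (hb : b ∉ U) (hc : c ∉ U) (he : e ∉ U)
    (hab : a < b) (hbc : b < c) (hce : c < e) :
    mm A (insert a (insert c U)) * mm A (insert b (insert e U)) =
      mm A (insert a (insert b U)) * mm A (insert c (insert e U)) +
      mm A (insert a (insert e U)) * mm A (insert b (insert c U)) := by
  obtain ⟨g, hg⟩ : ∃ g : Fin m → Fin n, g = ⇑(U.orderEmbOfFin hU) := ⟨_, rfl⟩
  have hgmem : ∀ z, z ∈ U ↔ ∃ i, g i = z := by
    intro z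
    have := Finset.range_orderEmbOfFin U hU
    have h2 : z ∈ Set.range g ↔ z ∈ (U : Set (Fin n)) := by rw [hg, this]
    rw [Set.mem_range, Finset.mem_coe] at h2
    exact h2.symm
  have hgU : ∀ i, g i ∈ U := fun i => (hgmem _).2 ⟨i, rfl⟩
  have hginj : Function.Injective g := by rw [hg]; exact (U.orderEmbOfFin hU).injective
  obtain ⟨τ, hτ⟩ : ∃ τ : Fin n → ℝ, ∀ u, τ u = ∏ i, sgp u (g i) := ⟨_, fun _ => rfl⟩
  have hττ : ∀ u, τ u * τ u = 1 := by
    intro u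
    rw [hτ, ← Finset.prod_mul_distrib]
    exact Finset.prod_eq_one fun i _ => sgp_sq _ _
  have key : ∀ u v, u ∉ U → v ∉ U → u < v →
      DD A (Fin.cons u (Fin.cons v g : Fin (m + 1) → Fin n)) =
        τ u * τ v * sg g * mm A (insert u (insert v U)) := by
    intro u v hu hv huv
    have hcard : (insert u (insert v U)).card = m + 2 := by
      rw [Finset.card_insert_of_notMem (by simp [hu, ne_of_lt huv]),
        Finset.card_insert_of_notMem hv, hU]
    have hinj : Function.Injective
        (Fin.cons u (Fin.cons v g : Fin (m + 1) → Fin n) : Fin (m + 2) → Fin n) := by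
      rw [Fin.cons_injective_iff, Fin.cons_injective_iff]
      refine ⟨?_, fun ⟨i, hi⟩ => hv (hi ▸ hgU i), hginj⟩
      rintro ⟨i, hi⟩
      revert hi
      refine Fin.cases ?_ (fun i => ?_) i
      · intro hi
        rw [Fin.cons_zero] at hi
        exact ne_of_gt huv hi
      · intro hi
        rw [Fin.cons_succ] at hi
        exact hu (hi ▸ hgU i)
    have hmem : ∀ z, z ∈ insert u (insert v U) ↔
        ∃ i, (Fin.cons u (Fin.cons v g : Fin (m + 1) → Fin n) : Fin (m + 2) → Fin n) i = z := by
      intro z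
      rw [Fin.exists_fin_succ, Fin.exists_fin_succ]
      simp only [Fin.cons_zero, Fin.cons_succ, Finset.mem_insert, hgmem]
      tauto
    rw [DD_eq A _ hinj _ hcard hmem, sg_cons, sg_cons, Fin.prod_univ_succ]
    simp only [Fin.cons_zero, Fin.cons_succ]
    rw [← hτ, ← hτ, mm, dif_pos hcard]
    have : sgp u v = 1 := by simp [sgp, huv]
    rw [this]
    ring
  have hP := DD_pluecker A g a b c e
  simp only at hP
  rw [key a c ha hc (hab.trans hbc), key b e hb he (hbc.trans hce), key a b ha hb hab,
    key c e hc he hce, key a e ha he ((hab.trans hbc).trans hce), key b c hb hc hbc] at hP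
  have hk : (τ a * τ b * τ c * τ e) * (τ a * τ b * τ c * τ e) = 1 := by
    calc _ = (τ a * τ a) * (τ b * τ b) * (τ c * τ c) * (τ e * τ e) := by ring
      _ = 1 := by rw [hττ, hττ, hττ, hττ]; norm_num
  have hs := sg_sq g
  have hP' : (τ a * τ b * τ c * τ e) *
      (mm A (insert a (insert c U)) * mm A (insert b (insert e U))) =
      (τ a * τ b * τ c * τ e) * (mm A (insert a (insert b U)) * mm A (insert c (insert e U)) +
      mm A (insert a (insert e U)) * mm A (insert b (insert c U))) := by
    linear_combination hP - (τ a * τ b * τ c * τ e) *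
      (mm A (insert a (insert c U)) * mm A (insert b (insert e U)) -
        (mm A (insert a (insert b U)) * mm A (insert c (insert e U)) +
      mm A (insert a (insert e U)) * mm A (insert b (insert c U)))) * hs
  have hne : τ a * τ b * τ c * τ e ≠ 0 := by
    intro h0
    rw [h0] at hk
    norm_num at hk
  exact mul_left_cancel₀ hne hP'

theorem NC4_of_TNN {n d : ℕ} (A : Matrix (Fin d) (Fin n) ℝ) (h0 : ∀ I, 0 ≤ mm A I)
    (P : Set (Fin n) → Prop) (hP : ∀ I : Finset (Fin n), P ↑I ↔ mm A I ≠ 0) : NC4 P := by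
  classical
  intro U s l p q hs hl hp hq hc h1 h2 h3 h4
  obtain ⟨V, rfl⟩ : ∃ V : Finset (Fin n), (V : Set (Fin n)) = U := ⟨U.toFinset, by simp⟩
  simp only [← Finset.coe_insert, hP] at h1 h2 h3 h4 ⊢
  rw [Finset.mem_coe] at hs hl hp hq
  have hd : d = V.card + 2 := by
    by_contra hcon
    refine h1 ?_
    rw [mm, dif_neg]
    rw [Finset.card_insert_of_notMem (by simp [hl, hc.ne.2.2.2.1]),
        Finset.card_insert_of_notMem hp]
    omega
  subst hd
  have pos : ∀ I, mm A I ≠ 0 → 0 < mm A I := fun I h => lt_of_le_of_ne (h0 I) h.symm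
  replace h1 := pos _ h1
  replace h2 := pos _ h2
  replace h3 := pos _ h3
  replace h4 := pos _ h4
  have sy : ∀ u v, insert u (insert v V) = insert v (insert u V) := fun u v =>
    Finset.insert_comm u v V
  have main : ∀ a b c e, a ∉ V → b ∉ V → c ∉ V → e ∉ V → a < b → b < c → c < e →
      0 < mm A (insert a (insert b V)) → 0 < mm A (insert c (insert e V)) →
      0 < mm A (insert a (insert e V)) → 0 < mm A (insert b (insert c V)) →
      mm A (insert a (insert c V)) ≠ 0 ∧ mm A (insert b (insert e V)) ≠ 0 := by
    intro a b c e ha hb hc he hab hbc hce k1 k2 k3 k4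
    have := mm_pluecker A V rfl a b c e ha hb hc he hab hbc hce
    have hpos : mm A (insert a (insert c V)) * mm A (insert b (insert e V)) ≠ 0 := by
      rw [this]; positivity
    exact ⟨left_ne_zero_of_mul hpos, right_ne_zero_of_mul hpos⟩
  have h1' := h1
  have h2' := h2
  have h3' := h3
  have h4' := h4
  rw [sy] at h1' h2' h3' h4'
  rcases hc with (⟨a, b, c⟩ | ⟨a, b, c⟩ | ⟨a, b, c⟩ | ⟨a, b, c⟩) |
    (⟨a, b, c⟩ | ⟨a, b, c⟩ | ⟨a, b, c⟩ | ⟨a, b, c⟩)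
  · exact (main s p l q hs hp hl hq a b c (by assumption) (by assumption) (by assumption) (by assumption)).1
  · rw [sy]; exact (main p l q s hp hl hq hs a b c (by assumption) (by assumption) (by assumption) (by assumption)).2
  · rw [sy]; exact (main l q s p hl hq hs hp a b c (by assumption) (by assumption) (by assumption) (by assumption)).1
  · exact (main q s p l hq hs hp hl a b c (by assumption) (by assumption) (by assumption) (by assumption)).2
  · exact (main s q l p hs hq hl hp a b c (by assumption) (by assumption) (by assumption) (by assumption)).1
  · rw [sy]; exact (main q l p s hq hl hp hs a b c (by assumption) (by assumption) (by assumption) (by assumption)).2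
  · rw [sy]; exact (main l p s q hl hp hs hq a b c (by assumption) (by assumption) (by assumption) (by assumption)).1
  · exact (main p s q l hp hs hq hl a b c (by assumption) (by assumption) (by assumption) (by assumption)).2

/-- A zero-one vector lies in the polytope only if it comes from a base. -/
theorem mem_of_indicator {n d : ℕ} (ℬ : Finset (Fin n) → Prop) (hrank : ∀ B, ℬ B → B.card = d)
    (B : Finset (Fin n)) (hB : B.card = d)
    (h : (fun i => if i ∈ B then (1 : ℝ) else 0) ∈ matroidPolytope ℬ) : ℬ B := by
  by_contra hnot
  let L : (Fin n → ℝ) →ₗ[ℝ] ℝ := ∑ i ∈ B, LinearMap.proj i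
  have hL : ∀ x, L x = ∑ i ∈ B, x i := fun x => by simp [L]
  have hsub : matroidPolytope ℬ ⊆ {x | L x ≤ (d : ℝ) - 1} := by
    refine convexHull_min ?_ (convex_halfSpace_le L.isLinear _)
    rintro _ ⟨C, hC, rfl⟩
    have hCd := hrank C hC
    rw [Set.mem_setOf_eq, hL]
    simp only [Finset.sum_ite_mem, Finset.sum_const, nsmul_eq_mul, mul_one]
    have hlt : (B ∩ C).card < d := by
      rw [← hB]
      refine Finset.card_lt_card ⟨Finset.inter_subset_left, fun hs => hnot ?_⟩
      have hBC : B ⊆ C := fun z hz => (Finset.mem_inter.1 (hs hz)).2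
      rw [Finset.eq_of_subset_of_card_le hBC (by omega)]
      exact hC
    have : ((B ∩ C).card : ℝ) + 1 ≤ d := by exact_mod_cast hlt
    linarith
  have := hsub h
  rw [Set.mem_setOf_eq, hL] at this
  simp only [Finset.sum_ite_mem, Finset.inter_self, Finset.sum_const, nsmul_eq_mul, mul_one, hB] at this
  linarith

theorem base_iff {n d : ℕ} (ℬ : Finset (Fin n) → Prop) (hrank : ∀ B, ℬ B → B.card = d)
    (a : Fin n → Fin n → ℝ) (h : matroidPolytope ℬ =
          {x : Fin n → ℝ | (∑ i, x i) = (d : ℝ) ∧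
            ∀ i j : Fin n, ∑ ℓ ∈ cycInt i j, x ℓ ≤ a i j}) (B : Finset (Fin n)) :
    ℬ B ↔ B.card = d ∧ ∀ i j, ((cycInt i j ∩ B).card : ℝ) ≤ a i j := by
  have e : (fun i => if i ∈ B then (1 : ℝ) else 0) ∈ matroidPolytope ℬ ↔
      B.card = d ∧ ∀ i j, ((cycInt i j ∩ B).card : ℝ) ≤ a i j := by
    rw [h, Set.mem_setOf_eq]
    simp only [Finset.sum_ite_mem, Finset.univ_inter, Finset.sum_const, nsmul_eq_mul, mul_one,
      Nat.cast_inj]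
  constructor
  · intro hB
    exact e.1 (subset_convexHull ℝ _ ⟨B, hB, rfl⟩)
  · intro hB
    exact mem_of_indicator ℬ hrank B hB.1 (e.2 hB)

theorem NC4_of_ineq {n d : ℕ} (a : Fin n → Fin n → ℝ) (P : Set (Fin n) → Prop)
    (hP : ∀ B : Finset (Fin n), P ↑B ↔ B.card = d ∧ ∀ i j, ((cycInt i j ∩ B).card : ℝ) ≤ a i j) :
    NC4 P := by
  classical
  intro U s l p q hs hl hp hq hc h1 h2 h3 h4
  obtain ⟨V, rfl⟩ : ∃ V : Finset (Fin n), (V : Set (Fin n)) = U := ⟨U.toFinset, by simp⟩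
  simp only [← Finset.coe_insert, hP] at h1 h2 h3 h4 ⊢
  rw [Finset.mem_coe] at hs hl hp hq
  obtain ⟨n1, n2, n3, n4, n5, n6⟩ := hc.ne
  have hcard : ∀ u v, u ∉ V → v ∉ V → u ≠ v → (insert u (insert v V)).card = V.card + 2 := by
    intro u v hu hv huv
    rw [Finset.card_insert_of_notMem (by simp [hu, huv]), Finset.card_insert_of_notMem hv]
  refine ⟨by rw [hcard s l hs hl n1, ← h1.1, hcard l p hl hp n4], fun i j => ?_⟩
  have hcnt : ∀ u v, u ∉ V → v ∉ V → u ≠ v → (cycInt i j ∩ insert u (insert v V)).card =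
      (if u ∈ cycInt i j then 1 else 0) + (if v ∈ cycInt i j then 1 else 0) +
        (cycInt i j ∩ V).card := by
    intro u v hu hv huv
    by_cases hu' : u ∈ cycInt i j <;> by_cases hv' : v ∈ cycInt i j <;>
      simp [Finset.inter_insert_of_mem, Finset.inter_insert_of_notMem, hu', hv', hu, hv, huv] <;> omega
  have key : ∀ u v, u ∉ V → v ∉ V → u ≠ v →
      (∀ i j, ((cycInt i j ∩ insert u (insert v V)).card : ℝ) ≤ a i j) →
      (if s ∈ cycInt i j then 1 else 0) + (if l ∈ cycInt i j then 1 else 0) ≤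
      (if u ∈ cycInt i j then 1 else 0) + (if v ∈ cycInt i j then 1 else 0) →
      ((cycInt i j ∩ insert s (insert l V)).card : ℝ) ≤ a i j := by
    intro u v hu hv huv hh hle
    refine le_trans ?_ (hh i j)
    rw [hcnt s l hs hl n1, hcnt u v hu hv huv]
    exact_mod_cast Nat.add_le_add_right hle _
  by_cases hs' : s ∈ cycInt i j
  · by_cases hl' : l ∈ cycInt i j
    · rcases hc.cycInt hs' hl' with h | h
      · exact key s p hs hp n2 h3.2 (by simp [hs', hl', h])
      · exact key s q hs hq n3 h4.2 (by simp [hs', hl', h])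
    · exact key s p hs hp n2 h3.2 (by simp [hs', hl'])
  · exact key l p hl hp n4 h1.2 (by simp [hs'])

/-- A rank-`d` matroid `M` on `[n]` is a positroid if and only
if there exist real numbers `a i j` such that the matroid polytope `Γ_M` is the
set of `x ∈ ℝ^n` with `x_1 + ... + x_n = d` and, for all `i, j ∈ [n]`,
`∑_{ℓ ∈ [i,j]} x_ℓ ≤ a i j`, where `[i,j]` is the cyclic interval. -/
theorem positroid_iff_cyclic_inequalities (n d : ℕ) (ℬ : Finset (Fin n) → Prop)
    (hmat : IsBasesSet ℬ) (hrank : ∀ B, ℬ B → B.card = d) :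
    IsPositroid ℬ ↔
      ∃ a : Fin n → Fin n → ℝ,
        matroidPolytope ℬ =
          {x : Fin n → ℝ | (∑ i, x i) = (d : ℝ) ∧
            ∀ i j : Fin n, ∑ ℓ ∈ cycInt i j, x ℓ ≤ a i j} := by
  classical
  obtain ⟨⟨B0, hB0⟩, hex⟩ := hmat
  obtain ⟨M, hE, hM⟩ := mk_matroid (fun S : Set (Fin n) => ℬ S.toFinset)
    ⟨(B0 : Set (Fin n)), by simpa using hB0⟩ (by
      intro B1 B2 h1 h2 b hb1 hb2
      obtain ⟨c, hc, h⟩ := hex h1 h2 b (by simp [hb1, hb2])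
      simp only [Finset.mem_sdiff, Set.mem_toFinset] at hc
      refine ⟨c, hc.1, hc.2, ?_⟩
      convert h using 1
      ext z; simp [and_comm])
  have hMB : ∀ B : Finset (Fin n), M.IsBase ↑B ↔ ℬ B := by
    intro B
    rw [hM]
    simp
  have hℬ : ℬ = fun B : Finset (Fin n) => M.IsBase ↑B := by
    funext B
    exact propext (hMB B).symm
  have hMd : ∀ B : Finset (Fin n), M.IsBase ↑B → B.card = d := fun B h =>
    hrank B ((hMB B).1 h)
  constructor
  · rintro ⟨d', A, hA, hR⟩
    have hmm : ∀ I : Finset (Fin n), M.IsBase ↑I ↔ mm A I ≠ 0 := by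
      intro I
      rw [hMB, hR I]
      unfold mm
      by_cases h : I.card = d'
      · rw [dif_pos h, ← linInd_iff]
        simp [h]
      · simp [h]
    have hpos : ∀ I, 0 ≤ mm A I := by
      intro I
      unfold mm
      split_ifs with h
      · exact hA.2 _ (I.orderEmbOfFin h).strictMono
      · exact le_refl _
    have hNC := NC_of_NC4 hE (NC4_of_TNN A hpos M.IsBase hmm)
    refine ⟨fun i j => ((M.eRk (cycInt i j : Set (Fin n))).toNat : ℝ), ?_⟩
    have := polytope_of_NC M hE hNC d hMd
    rw [← hℬ] at this
    exact this
  · rintro ⟨a, ha⟩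
    have hbi := base_iff ℬ hrank a ha
    have hNC := NC_of_NC4 hE (NC4_of_ineq (d := d) a M.IsBase (fun B => (hMB B).trans (hbi B)))
    obtain ⟨A, hA⟩ := realize _ M rfl hE hNC hMd
    refine ⟨d, A, ⟨?_, ?_⟩, ?_⟩
    · have h0 := hrank B0 hB0
      exact rank_eq A B0 h0 ((hA B0 h0).2.2 ((hMB B0).2 hB0))
    · intro f hf
      obtain ⟨I, h, e⟩ := strictMono_minor A f hf
      have := (hA I h).1
      rw [← e] at this
      exact this
    · intro B
      constructor
      · intro hB
        have h := hrank B hB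
        exact ⟨h, (linInd_iff A B h).2 ((hA B h).2.2 ((hMB B).2 hB))⟩
      · rintro ⟨h, hl⟩
        exact (hMB B).1 ((hA B h).2.1 ((linInd_iff A B h).1 hl))
end

section
/- Let M be a rank-d positroid on [n]. Then every nonempty face of the matroid polytope Γ_M is itself the matroid polytope of a positroid: if F is Γ_M itself or the set of points of Γ_M minimizing some linear functional w ∈ (ℝ^n)*, then there exists a positroid N on [n] (necessarily of rank d) with F = Γ_N. -/
open Finset

theorem aux_li {d : ℕ} {E : Type*} [Fintype E] (A : Matrix (Fin d) E ℝ) (B : Finset E)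
    (e : Fin d ≃ B) :
    LinearIndependent ℝ (fun j : B => fun i => A i j.1) ↔
      (A.submatrix id (fun k => (e k).1)).det ≠ 0 := by
  rw [← linearIndependent_equiv e, ← isUnit_iff_ne_zero, ← Matrix.isUnit_iff_isUnit_det,
    ← Matrix.linearIndependent_cols_iff_isUnit]
  rfl

theorem aux_inj {d : ℕ} {E : Type*} (A : Matrix (Fin d) E ℝ) (f : Fin d → E)
    (h : (A.submatrix id f).det ≠ 0) : Function.Injective f := by
  intro a b hab
  by_contra hne
  apply h
  apply Matrix.det_zero_of_column_eq hne
  intro k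
  simp [hab]

theorem aux_repr {d : ℕ} {E : Type*} [Fintype E] [DecidableEq E] (A : Matrix (Fin d) E ℝ)
    (ℬ : Finset E → Prop) (hr : A.RepresentsBases ℬ) (f : Fin d → E)
    (h : (A.submatrix id f).det ≠ 0) : ℬ (Finset.univ.image f) := by
  have hf := aux_inj A f h
  rw [hr]
  refine ⟨by simp [Finset.card_image_of_injective _ hf], ?_⟩
  let e : Fin d ≃ (Finset.univ.image f : Finset E) :=
    Equiv.ofBijective (fun k => ⟨f k, by simp⟩) ⟨fun a b hab => hf (by simpa using hab), by
      rintro ⟨x, hx⟩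
      obtain ⟨k, -, rfl⟩ := Finset.mem_image.1 hx
      exact ⟨k, rfl⟩⟩
  exact (aux_li A _ e).2 h

theorem aux_rank {d : ℕ} {E : Type*} [Fintype E] (A : Matrix (Fin d) E ℝ)
    (f : Fin d → E) (h : (A.submatrix id f).det ≠ 0) : A.rank = d := by
  apply le_antisymm
  · simpa using A.rank_le_card_height
  · have h1 : (A.submatrix id f).rank = d := by
      simpa using Matrix.rank_of_isUnit _ ((Matrix.isUnit_iff_isUnit_det _).2 (isUnit_iff_ne_zero.2 h))
    refine h1.symm.le.trans ?_
    rw [Matrix.rank_eq_finrank_span_cols, Matrix.rank_eq_finrank_span_cols]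
    apply Submodule.finrank_mono
    apply Submodule.span_mono
    rintro _ ⟨k, rfl⟩
    exact ⟨f k, rfl⟩

theorem aux_exists {d : ℕ} {E : Type*} [Fintype E] (A : Matrix (Fin d) E ℝ)
    (h : A.rank = d) : ∃ f : Fin d → E, (A.submatrix id f).det ≠ 0 := by
  obtain ⟨κ, a, ha, hspan, hli⟩ := exists_linearIndependent' ℝ A.col
  have : Finite κ := Finite.of_injective a ha
  have : Fintype κ := Fintype.ofFinite κ
  have hc : Fintype.card κ = d := by
    rw [← finrank_span_eq_card hli, hspan, ← Matrix.rank_eq_finrank_span_cols, h]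
  let e : Fin d ≃ κ := (Fintype.equivFinOfCardEq hc).symm
  refine ⟨a ∘ e, ?_⟩
  rw [← isUnit_iff_ne_zero, ← Matrix.isUnit_iff_isUnit_det,
    ← Matrix.linearIndependent_cols_iff_isUnit]
  exact hli.comp e e.injective

/-- The initial degeneration of a matrix in normal form. -/
theorem aux_det {d : ℕ} {E : Type*} (C : Matrix (Fin d) E ℝ) (u : E → ℝ) (b : Fin d → E)
    (hC : ∀ i j, C i j ≠ 0 → u (b i) ≤ u j) (f : Fin d → E) [DecidableEq ℝ] :
    ((Matrix.of fun i j => if u j = u (b i) then C i j else 0).submatrix id f).det =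
      if ∑ k, u (f k) = ∑ k, u (b k) then (C.submatrix id f).det else 0 := by
  rw [Matrix.det_apply', Matrix.det_apply']
  have key : ∀ σ : Equiv.Perm (Fin d), ∑ k, u (f k) = ∑ i, u (f (σ⁻¹ i)) := fun σ =>
    (Equiv.sum_comp σ⁻¹ (fun k => u (f k))).symm
  have key2 : ∀ σ : Equiv.Perm (Fin d), ∑ k, u (b k) = ∑ i, u (b (σ i)) := fun σ =>
    (Equiv.sum_comp σ (fun k => u (b k))).symm
  split_ifs with h
  · apply Finset.sum_congr rfl
    intro σ _
    congr 1
    by_cases hz : ∃ i, C (σ i) (f i) = 0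
    · obtain ⟨i, hi⟩ := hz
      rw [Finset.prod_eq_zero (Finset.mem_univ i), Finset.prod_eq_zero (Finset.mem_univ i)]
      · simpa using hi
      · simp [hi]
    · push Not at hz
      have hle : ∀ i ∈ Finset.univ, u (b (σ i)) ≤ u (f i) := fun i _ => hC _ _ (hz i)
      rw [key2 σ] at h
      have := (Finset.sum_eq_sum_iff_of_le hle).1 h.symm
      apply Finset.prod_congr rfl
      intro i hi
      simp [this i hi]
  · apply Finset.sum_eq_zero
    intro σ _
    rw [key2 σ] at h
    have : ∃ i, u (f i) ≠ u (b (σ i)) := by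
      by_contra hcon
      push Not at hcon
      exact h (Finset.sum_congr rfl fun i _ => hcon i)
    obtain ⟨i, hi⟩ := this
    rw [Finset.prod_eq_zero (Finset.mem_univ i), mul_zero]
    simp [hi]

theorem aux_matrix {d : ℕ} {E : Type*} [Fintype E] [LinearOrder E] (ℬ : Finset E → Prop)
    (hpos : IsPositroidOfRank d ℬ) (u : E → ℝ) :
    ∃ m : ℝ, (∀ B, ℬ B → m ≤ ∑ i ∈ B, u i) ∧ (∃ B, ℬ B ∧ ∑ i ∈ B, u i = m) ∧
      IsPositroidOfRank d (fun B => ℬ B ∧ ∑ i ∈ B, u i = m) := by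
  classical
  obtain ⟨A, ⟨hrk, hnn⟩, hr⟩ := hpos
  obtain ⟨f0, hf0⟩ := aux_exists A hrk
  obtain ⟨B, hB, hmin⟩ := Finset.exists_min_image (Finset.univ.filter ℬ) (fun B => ∑ i ∈ B, u i)
    ⟨_, Finset.mem_filter.2 ⟨Finset.mem_univ _, aux_repr A ℬ hr f0 hf0⟩⟩
  replace hB := (Finset.mem_filter.1 hB).2
  replace hmin : ∀ B', ℬ B' → ∑ i ∈ B, u i ≤ ∑ i ∈ B', u i := fun B' h' =>
    hmin B' (Finset.mem_filter.2 ⟨Finset.mem_univ _, h'⟩)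
  refine ⟨_, hmin, ⟨B, hB, rfl⟩, ?_⟩
  obtain ⟨hcard, hli⟩ := (hr B).1 hB
  let e := B.orderIsoOfFin hcard
  have hsum : ∀ (B' : Finset E) (e : Fin d ≃ B'), ∑ i ∈ B', u i = ∑ k, u (e k).1 := by
    intro B' e
    rw [← Finset.sum_coe_sort, ← Equiv.sum_comp e]
  rw [hsum B e.toEquiv]
  let b : Fin d → E := fun k => (e k).1
  have hbm : StrictMono b := fun x y hxy => e.strictMono hxy
  have hdet : (A.submatrix id b).det ≠ 0 := (aux_li A B e.toEquiv).1 hli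
  have hdpos : 0 < (A.submatrix id b).det := lt_of_le_of_ne (hnn b hbm) hdet.symm
  have hunit : IsUnit (A.submatrix id b).det := isUnit_iff_ne_zero.2 hdet
  let C : Matrix (Fin d) E ℝ := (A.submatrix id b)⁻¹ * A
  have hCsub : ∀ f : Fin d → E, C.submatrix id f = (A.submatrix id b)⁻¹ * A.submatrix id f :=
    fun f => rfl
  have hCdet : ∀ f : Fin d → E,
      (C.submatrix id f).det = (A.submatrix id b).det⁻¹ * (A.submatrix id f).det := by
    intro f
    rw [hCsub, Matrix.det_mul, Matrix.det_nonsing_inv, Ring.inverse_eq_inv']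
  have hCb : C.submatrix id b = 1 := by
    rw [hCsub, Matrix.nonsing_inv_mul _ hunit]
  have hC : ∀ i j, C i j ≠ 0 → u (b i) ≤ u j := by
    intro i j hij
    have h1 : (C.submatrix id (Function.update b i j)).det = C i j := by
      have : C.submatrix id (Function.update b i j) =
          (1 : Matrix (Fin d) (Fin d) ℝ).updateCol i (fun k => C k j) := by
        rw [← hCb]
        ext x y
        by_cases hy : y = i
        · subst hy; simp
        · simp [hy]
      rw [this, ← Matrix.cramer_apply, Matrix.cramer_one]
      rfl
    have h2 : (A.submatrix id (Function.update b i j)).det ≠ 0 := by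
      intro h0
      rw [hCdet, h0, mul_zero] at h1
      exact hij h1.symm
    have h3 := hmin _ (aux_repr A ℬ hr _ h2)
    rw [Finset.sum_image (fun x _ y _ h => aux_inj A _ h2 h), hsum B e.toEquiv] at h3
    change ∑ k, u (b k) ≤ _ at h3
    rw [← Finset.add_sum_erase _ _ (Finset.mem_univ i),
      ← Finset.add_sum_erase _ (fun k => u (Function.update b i j k)) (Finset.mem_univ i)] at h3
    have h4 : ∑ k ∈ Finset.univ.erase i, u (Function.update b i j k) =
        ∑ k ∈ Finset.univ.erase i, u (b k) := by
      apply Finset.sum_congr rfl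
      intro k hk
      rw [Function.update_of_ne (Finset.ne_of_mem_erase hk)]
    rw [h4] at h3
    simpa only [Function.update_self, add_le_add_iff_right] using h3
  have hD := aux_det C u b hC
  refine ⟨Matrix.of fun i j => if u j = u (b i) then C i j else 0, ⟨?_, ?_⟩, ?_⟩
  · apply aux_rank _ b
    rw [hD, if_pos rfl, hCb]
    simp
  · intro f hf
    rw [hD, hCdet]
    split_ifs
    · exact mul_nonneg (inv_nonneg.2 hdpos.le) (hnn f hf)
    · exact le_rfl
  · intro B'
    beta_reduce
    rw [hr B', and_assoc]
    refine and_congr_right fun hc => ?_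
    let e' := (B'.orderIsoOfFin hc).toEquiv
    rw [aux_li _ B' e', aux_li _ B' e', hD, hCdet, hsum B' e']
    change _ ∧ _ = ∑ k, u (b k) ↔ _
    split_ifs with h
    · simp [h, hdet]
    · simp [h]

theorem aux_face {V : Type*} [AddCommGroup V] [Module ℝ V] (S : Set V) (w : V →ₗ[ℝ] ℝ) (m : ℝ)
    (hm : ∀ s ∈ S, m ≤ w s) (hex : ∃ s ∈ S, w s = m) :
    {x ∈ convexHull ℝ S | ∀ y ∈ convexHull ℝ S, w x ≤ w y} =
      convexHull ℝ {s ∈ S | w s = m} := by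
  have hT : ∀ x ∈ convexHull ℝ {s ∈ S | w s = m}, w x = m := by
    intro x hx
    exact convexHull_min (t := {x | w x = m}) (fun s hs => hs.2)
      (convex_hyperplane w.isLinear m) hx
  have hS : ∀ x ∈ convexHull ℝ S, m ≤ w x := by
    intro x hx
    exact convexHull_min (t := {x | m ≤ w x}) hm (convex_halfSpace_ge w.isLinear m) hx
  apply Set.Subset.antisymm
  · rintro x ⟨hx, hxm⟩
    obtain ⟨s, hs, hsm⟩ := hex
    have hle : w x ≤ m := hsm ▸ hxm s (subset_convexHull ℝ S hs)
    have hK : Convex ℝ ({x | m < w x} ∪ convexHull ℝ {s ∈ S | w s = m}) := by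
      rw [convex_iff_forall_pos]
      have hge : ∀ z ∈ ({x | m < w x} ∪ convexHull ℝ {s ∈ S | w s = m}), m ≤ w z := by
        rintro z (hz | hz)
        · exact le_of_lt hz
        · exact (hT z hz).ge
      intro y hy z hz a c ha hc hac
      have e1 : m = a * m + c * m := by rw [← add_mul, hac, one_mul]
      have hym := hge y hy
      rcases hy with hy' | hy'
      · left
        have h2 := mul_le_mul_of_nonneg_left (hge z hz) hc.le
        have h1 := mul_lt_mul_of_pos_left (show m < w y from hy') ha
        simp only [Set.mem_ofPred_eq, map_add, map_smul, smul_eq_mul]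
        linarith
      · rcases hz with hz' | hz'
        · left
          have h2 := mul_le_mul_of_nonneg_left hym ha.le
          have h1 := mul_lt_mul_of_pos_left (show m < w z from hz') hc
          simp only [Set.mem_ofPred_eq, map_add, map_smul, smul_eq_mul]
          linarith
        · right
          exact convex_convexHull ℝ _ hy' hz' ha.le hc.le hac
    have hsub : S ⊆ {x | m < w x} ∪ convexHull ℝ {s ∈ S | w s = m} := by
      intro s hs
      rcases (hm s hs).lt_or_eq with h | h
      · exact Or.inl h
      · exact Or.inr (subset_convexHull ℝ _ ⟨hs, h.symm⟩)
    rcases convexHull_min hsub hK hx with h | h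
    · exact absurd h (not_lt.2 hle)
    · exact h
  · intro x hx
    refine ⟨convexHull_mono (fun s hs => hs.1) hx, fun y hy => ?_⟩
    rw [hT x hx]
    exact hS y hy

/-- Let `M` be a rank-`d` positroid on `[n]`.  Then every
nonempty face of the matroid polytope `Γ_M` is itself the matroid polytope of a
positroid: if `F` is `Γ_M` itself or the set of points of `Γ_M` minimizing some
linear functional `w`, then there is a positroid `N` on `[n]`, necessarily of
rank `d`, with `F = Γ_N`. -/
theorem face_of_positroid_polytope (n d : ℕ) (ℬ : Finset (Fin n) → Prop)
    (hpos : IsPositroidOfRank d ℬ) (F : Set (Fin n → ℝ))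
    (hF : F = matroidPolytope ℬ ∨
      ∃ w : (Fin n → ℝ) →ₗ[ℝ] ℝ,
        F = {x ∈ matroidPolytope ℬ | ∀ y ∈ matroidPolytope ℬ, w x ≤ w y}) :
    ∃ ℬ' : Finset (Fin n) → Prop, IsPositroidOfRank d ℬ' ∧ F = matroidPolytope ℬ' := by
  rcases hF with rfl | ⟨w, rfl⟩
  · exact ⟨ℬ, hpos, rfl⟩
  · have hw : ∀ B : Finset (Fin n), w (fun i => if i ∈ B then (1 : ℝ) else 0) =
        ∑ i ∈ B, w (Pi.single i 1) := by
      intro B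
      rw [← map_sum]
      congr 1
      ext i
      simp [Finset.sum_apply, Pi.single_apply]
    obtain ⟨m, hmin, ⟨B, hB, hBm⟩, hN⟩ := aux_matrix ℬ hpos (fun i => w (Pi.single i 1))
    refine ⟨_, hN, ?_⟩
    unfold matroidPolytope
    rw [aux_face _ w m]
    · congr 1
      ext x
      constructor
      · rintro ⟨⟨B', hB', rfl⟩, h⟩
        exact ⟨B', ⟨hB', by rw [← hw, h]⟩, rfl⟩
      · rintro ⟨B', ⟨hB', h⟩, rfl⟩
        exact ⟨⟨B', hB', rfl⟩, by rw [hw, h]⟩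
    · rintro _ ⟨B', hB', rfl⟩
      rw [hw]
      exact hmin B' hB'
    · exact ⟨_, ⟨B, hB, rfl⟩, by rw [hw, hBm]⟩
end
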